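/- Let f₀(x) = (x² − x − 1)⁵·(x² − x − 1/16) − (1/8)·x³·(x − 1)³·(x³ − 2) ∈ ℚ[x]. Then f₀ is irreducible over ℚ, the Galois group of its splitting field over ℚ is a simple group of cardinality 7920 (i.e., isomorphic to the Mathieu group M₁₁), and the root field K = ℚ[x]/(f₀) is a degree-12 number field with discriminant 2⁸·3¹⁶·97⁴. -/

import Mathlib

open Polynomial

/-- `f₀(x) = (x² − x − 1)⁵ (x² − x − 1/16) − (1/8) · x³ (x − 1)³ (x³ − 2)` over `ℚ`. -/
noncomputable def f0 : Polynomial ℚ :=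
  (X ^ 2 - X - 1) ^ 5 * (X ^ 2 - X - C (1 / 16 : ℚ)) -
    C (1 / 8 : ℚ) * (X ^ 3 * (X - 1) ^ 3 * (X ^ 3 - 2))


namespace M11

def rw (x : ℕ) : ℕ := Nat.land (Nat.shiftRight 1962420277011672798168549293534647035903 (Nat.mul 11 x)) 2047

def bt (n k : ℕ) : ℕ := Nat.land (Nat.shiftRight n k) 1

/-- popcount of the low 11 bits -/
def pc (n : ℕ) : ℕ :=
  Nat.add (bt n 0) (Nat.add (bt n 1) (Nat.add (bt n 2) (Nat.add (bt n 3) (Nat.add (bt n 4)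
  (Nat.add (bt n 5) (Nat.add (bt n 6) (Nat.add (bt n 7) (Nat.add (bt n 8) (Nat.add (bt n 9)
  (bt n 10))))))))))

def N4 (x y z w : ℕ) : ℕ :=
  pc (Nat.xor 2047 (Nat.lor (Nat.xor (rw x) (rw y)) (Nat.lor (Nat.xor (rw x) (rw z))
    (Nat.xor (rw x) (rw w)))))

def gt : List ℕ → ℕ → ℕ
  | [], _ => 0
  | a :: _, 0 => a
  | _ :: l, n + 1 => gt l n

def trip : List (ℕ × ℕ × ℕ) :=
  [(0,1,2),(0,1,3),(0,2,3),(1,2,3),(0,1,4),(0,2,4),(0,3,4),(1,2,4),(1,3,4),(2,3,4)]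

def okE (k : ℕ) (l : List ℕ) (y : ℕ) : Bool :=
  !(l.contains y) && trip.all fun t => Nat.ble k t.2.2 ||
    Nat.beq (N4 t.1 t.2.1 t.2.2 k) (N4 (gt l t.1) (gt l t.2.1) (gt l t.2.2) y)

def lev : ℕ → List (List ℕ)
  | 0 => [[0, 1]]
  | n + 1 => (lev n).flatMap fun l =>
      ((List.range 12).filter (okE (n + 2) l)).map fun y => l ++ [y]

def cmp (p q : List ℕ) : List ℕ := q.map fun i => gt p i

def idL : List ℕ := List.range 12
def cL : List ℕ := [0, 2, 3, 4, 5, 6, 7, 8, 9, 10, 11, 1]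

def pwL (p : List ℕ) : ℕ → List ℕ
  | 0 => idL
  | n + 1 => cmp p (pwL p n)

def wordL (c d : List ℕ) (w : List ℕ) (i : ℕ) : List ℕ :=
  cmp (cmp (pwL c (gt w i)) (pwL d (gt w (i+1))))
    (cmp (pwL c (gt w (i+2))) (pwL d (gt w (i+3))))

def prodsL (x y p q : List ℕ) : List (List ℕ × List ℕ) :=
  (List.range 5).flatMap fun i => (List.range 3).flatMap fun j =>
    (List.range 2).flatMap fun a => (List.range 2).map fun b =>
      (cmp (pwL x i) (pwL y j), cmp (pwL p a) (pwL q b))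

def keyL (p q : List ℕ) : ℕ := Nat.add (gt p (gt q 2)) (Nat.mul 12 (Nat.add (gt p (gt q 3))
  (Nat.mul 12 (Nat.add (gt p (gt q 1)) (Nat.mul 12 (gt p (gt q 0)))))))

def maskL : List (List ℕ × List ℕ) → ℕ
  | [] => 0
  | t :: l => Nat.lor (Nat.shiftLeft 1 (keyL t.1 t.2)) (maskL l)

def mask0 : ℕ := maskL ((lev 10).map fun l => (l, idL))

def chkU (u w : List ℕ) : Bool :=
  let d := cmp (cmp u cL) u
  Nat.beq mask0
    (maskL (prodsL (wordL cL d w 0) (wordL cL d w 4) (wordL cL d w 8) (wordL cL d w 12)))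

def allc : List (List ℕ) → List (List ℕ) → Bool
  | [], _ => true
  | _ :: _, [] => false
  | u :: us, w :: ws => chkU u w && allc us ws

def WL : List (List ℕ) := [[0,0,6,2,0,0,1,9,0,0,3,6,0,2,3,4],[0,0,1,6,0,1,7,6,0,0,2,5,0,2,8,2],[0,0,2,8,0,0,4,3,0,0,1,2,0,6,10,3],[0,0,4,7,0,1,7,7,0,0,3,8,0,1,1,1],[0,0,1,7,0,1,2,5,0,0,2,4,0,1,3,9],[0,0,2,7,0,1,3,3,0,0,5,6,0,2,2,2],[0,0,1,10,0,0,2,8,0,0,7,1,0,3,4,7],[0,0,1,2,0,1,1,4,0,0,2,9,0,3,3,3],[0,0,1,8,0,1,1,2,0,0,2,3,0,1,3,1],[0,0,1,3,0,0,2,2,0,0,3,7,0,2,9,4],[0,0,3,4,0,2,9,1,0,0,1,10,0,4,4,4],[0,0,2,9,0,0,7,2,0,0,1,6,0,3,10,2],[0,0,1,5,0,0,3,1,0,0,2,3,0,3,5,7],[0,0,1,10,0,1,4,2,0,0,2,1,0,3,3,5],[0,0,2,9,0,0,6,8,0,0,4,2,0,1,7,8]]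

theorem lev_facts : (lev 10).length = 60 ∧ ((lev 10).map fun l => keyL l idL).Nodup ∧
    allc ((lev 10).filter fun u => (cmp u u == idL) && !(u == idL)) WL = true ∧
    ((lev 10).all fun l => Nat.beq (gt l 0) 0 && Nat.beq (gt l 1) 1 && Nat.blt (gt l 2) 12 &&
      Nat.blt (gt l 3) 12) = true := by
  decide +kernel

theorem lev_key : ∀ l ∈ lev 10, ∃ a b, a < 12 ∧ b < 12 ∧
    keyL l idL = a + 12 * (b + 12 * (1 + 12 * 0)) := by
  intro l hl
  have h := List.all_eq_true.1 lev_facts.2.2.2 l hl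
  simp only [Bool.and_eq_true] at h
  obtain ⟨⟨⟨h0, h1⟩, h2⟩, h3⟩ := h
  refine ⟨gt l 2, gt l 3, Nat.le_of_ble_eq_true h2, Nat.le_of_ble_eq_true h3, ?_⟩
  have e0 := Nat.eq_of_beq_eq_true h0
  have e1 := Nat.eq_of_beq_eq_true h1
  show gt l 2 + 12 * (gt l 3 + 12 * (gt l 1 + 12 * gt l 0)) = _
  rw [e0, e1]

theorem gt_map_range (f : ℕ → ℕ) : ∀ (m i : ℕ), i < m → gt ((List.range m).map f) i = f i := by
  intro m
  induction m generalizing f with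
  | zero => intro i hi; omega
  | succ m ih =>
    intro i hi
    rw [List.range_succ_eq_map, List.map_cons, List.map_map]
    cases i with
    | zero => rfl
    | succ i =>
      show gt (List.map (f ∘ Nat.succ) (List.range m)) i = _
      rw [ih _ i (by omega)]; rfl

abbrev P12 := Equiv.Perm (Fin 12)

def vP (σ : P12) (n : ℕ) : ℕ := if h : n < 12 then (σ ⟨n, h⟩ : Fin 12) else 0

def tl (σ : P12) : List ℕ := (List.range 12).map (vP σ)

theorem vP_lt (σ : P12) (n : ℕ) : vP σ n < 12 := by
  unfold vP; split_ifs <;> omega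

theorem vP_mul (σ τ : P12) (n : ℕ) (hn : n < 12) : vP (σ * τ) n = vP σ (vP τ n) := by
  simp [vP, hn]

theorem gt_tl (σ : P12) (n : ℕ) (hn : n < 12) : gt (tl σ) n = vP σ n := gt_map_range _ _ _ hn

theorem cmp_tl (σ τ : P12) : cmp (tl σ) (tl τ) = tl (σ * τ) := by
  unfold cmp
  conv_lhs => rw [tl.eq_1 τ]
  rw [List.map_map]
  apply List.map_congr_left
  intro n hn
  rw [List.mem_range] at hn
  rw [Function.comp_apply, gt_tl _ _ (vP_lt _ _), vP_mul _ _ _ hn]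

theorem tl_one : tl 1 = idL := by
  unfold tl idL
  conv_rhs => rw [← List.map_id (List.range 12)]
  apply List.map_congr_left
  intro n hn
  rw [List.mem_range] at hn
  simp [vP, hn]

theorem tl_inj {σ τ : P12} (h : tl σ = tl τ) : σ = τ := by
  ext x
  have h1 := gt_tl σ x x.2
  rw [h, gt_tl τ x x.2] at h1
  simpa [vP] using h1.symm

theorem pw_tl (σ : P12) (n : ℕ) : pwL (tl σ) n = tl (σ ^ n) := by
  induction n with
  | zero => rw [pow_zero, tl_one]; rfl
  | succ n ih => rw [pow_succ', ← cmp_tl, ← ih]; rfl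

def Inv (σ : P12) : Prop := ∀ x y z w : Fin 12, N4 (σ x) (σ y) (σ z) (σ w) = N4 x y z w

theorem Inv.nat {σ : P12} (h : Inv σ) (x y z w : ℕ) (hx : x < 12) (hy : y < 12) (hz : z < 12)
    (hw : w < 12) : N4 (vP σ x) (vP σ y) (vP σ z) (vP σ w) = N4 x y z w := by
  simpa [vP, hx, hy, hz, hw] using h ⟨x, hx⟩ ⟨y, hy⟩ ⟨z, hz⟩ ⟨w, hw⟩

theorem vP_inj {σ : P12} {x y : ℕ} (hx : x < 12) (hy : y < 12) (h : vP σ x = vP σ y) : x = y := by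
  simp only [vP, hx, hy, dif_pos] at h
  have := σ.injective (Fin.ext h)
  simpa using this

theorem mem_lev {σ : P12} (h : Inv σ) (h0 : σ 0 = 0) (h1 : σ 1 = 1) :
    ∀ n ≤ 10, (List.range (n + 2)).map (vP σ) ∈ lev n := by
  intro n
  induction n with
  | zero =>
    intro _
    have e0 : vP σ 0 = 0 := by
      have : vP σ 0 = (σ 0 : Fin 12) := rfl
      rw [this, h0]; rfl
    have e1 : vP σ 1 = 1 := by
      have : vP σ 1 = (σ 1 : Fin 12) := rfl
      rw [this, h1]; rfl
    simp [List.range_succ, lev, e0, e1]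
  | succ n ih =>
    intro hn
    have ih := ih (by omega)
    rw [show n + 1 + 2 = (n + 2) + 1 by omega, List.range_succ, List.map_append]
    show _ ∈ (lev n).flatMap _
    rw [List.mem_flatMap]
    refine ⟨_, ih, ?_⟩
    rw [List.mem_map]
    refine ⟨vP σ (n + 2), ?_, rfl⟩
    rw [List.mem_filter, List.mem_range]
    refine ⟨vP_lt _ _, ?_⟩
    unfold okE
    rw [Bool.and_eq_true]
    constructor
    · rw [Bool.not_eq_true', ← Bool.not_eq_true, List.contains_iff_mem, List.mem_map]
      rintro ⟨m, hm, hm2⟩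
      rw [List.mem_range] at hm
      have := vP_inj (by omega) (by omega) hm2
      omega
    · rw [List.all_eq_true]
      intro t ht
      rw [Bool.or_eq_true]
      by_cases hk : n + 2 ≤ t.2.2
      · left; exact Nat.ble_eq_true_of_le hk
      · right
        have hlt : t.1 < t.2.1 ∧ t.2.1 < t.2.2 := by
          clear hk
          revert t; decide
        rw [gt_map_range _ _ _ (by omega), gt_map_range _ _ _ (by omega),
          gt_map_range _ _ _ (by omega), h.nat _ _ _ _ (by omega) (by omega) (by omega) (by omega)]
        exact Nat.beq_refl _

theorem tl_mem_lev {σ : P12} (h : Inv σ) (h0 : σ 0 = 0) (h1 : σ 1 = 1) : tl σ ∈ lev 10 :=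
  mem_lev h h0 h1 10 le_rfl

theorem allc_sound : ∀ (us ws : List (List ℕ)), allc us ws = true → ∀ u ∈ us, ∃ w, chkU u w = true := by
  intro us
  induction us with
  | nil => simp
  | cons v us ih =>
    intro ws h u hu
    cases ws with
    | nil => simp [allc] at h
    | cons w ws =>
      simp only [allc, Bool.and_eq_true] at h
      rcases List.mem_cons.1 hu with rfl | hu
      · exact ⟨w, h.1⟩
      · exact ih ws h.2 u hu

theorem maskL_bit : ∀ (l : List (List ℕ × List ℕ)) (k : ℕ),
    (maskL l).testBit k = true ↔ ∃ t ∈ l, keyL t.1 t.2 = k := by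
  intro l k
  induction l with
  | nil => simp [maskL]
  | cons t l ih =>
    have : maskL (t :: l) = (1 <<< (keyL t.1 t.2)) ||| maskL l := rfl
    rw [this, Nat.testBit_or, Bool.or_eq_true, ih, Nat.shiftLeft_eq, one_mul, Nat.testBit_two_pow]
    simp

theorem key_tl (σ τ : P12) : keyL (tl σ) (tl τ) = vP (σ * τ) 2 + 12 * (vP (σ * τ) 3 +
    12 * (vP (σ * τ) 1 + 12 * vP (σ * τ) 0)) := by
  unfold keyL
  rw [gt_tl τ _ (by norm_num), gt_tl τ _ (by norm_num), gt_tl τ _ (by norm_num),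
    gt_tl τ _ (by norm_num), gt_tl σ _ (vP_lt _ _), gt_tl σ _ (vP_lt _ _), gt_tl σ _ (vP_lt _ _),
    gt_tl σ _ (vP_lt _ _), vP_mul _ _ _ (by norm_num), vP_mul _ _ _ (by norm_num),
    vP_mul _ _ _ (by norm_num), vP_mul _ _ _ (by norm_num)]
  rfl

/-- the 11-cycle -/
def cFun (i : Fin 12) : Fin 12 := if i = 0 then 0 else if i = 11 then 1 else i + 1
def cInv (i : Fin 12) : Fin 12 := if i = 0 then 0 else if i = 1 then 11 else i - 1
def cP : P12 := ⟨cFun, cInv, by unfold Function.LeftInverse; decide, by unfold Function.RightInverse Function.LeftInverse; decide⟩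

theorem tl_c : tl cP = cL := by decide

theorem stab_all (H : Subgroup P12) (hc : cP ∈ H) (u : P12) (hu : u * cP * u ∈ H) (hui : Inv u)
    (hu2 : u * u = 1) (hu1 : u ≠ 1) (hu00 : u 0 = 0) (hu11 : u 1 = 1) (hH : ∀ σ ∈ H, Inv σ) :
    ∀ l ∈ lev 10, ∃ σ ∈ H, tl σ = l := by
  obtain ⟨hlen, hnd, hall, -⟩ := lev_facts
  have hum := tl_mem_lev hui hu00 hu11
  obtain ⟨w, hw⟩ := allc_sound _ _ hall (tl u) (by
    rw [List.mem_filter]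
    refine ⟨hum, ?_⟩
    rw [cmp_tl, hu2, tl_one]
    have : tl u ≠ idL := by
      rw [← tl_one]; exact fun h => hu1 (tl_inj h)
    simp [this])
  have hd : cmp (cmp (tl u) cL) (tl u) = tl (u * cP * u) := by
    rw [← tl_c, cmp_tl, cmp_tl]
  set d := u * cP * u with hdd
  have hword : ∀ i, ∃ σ ∈ H, wordL cL (tl d) w i = tl σ := by
    intro i
    refine ⟨(cP ^ (gt w i) * d ^ (gt w (i+1))) * (cP ^ (gt w (i+2)) * d ^ (gt w (i+3))), ?_, ?_⟩
    rotate_left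
    · unfold wordL
      rw [← tl_c, pw_tl, pw_tl, pw_tl, pw_tl, cmp_tl, cmp_tl, cmp_tl]
    · exact H.mul_mem (H.mul_mem (H.pow_mem hc _) (H.pow_mem hu _))
        (H.mul_mem (H.pow_mem hc _) (H.pow_mem hu _))
  obtain ⟨x, hx, ex⟩ := hword 0
  obtain ⟨y, hy, ey⟩ := hword 4
  obtain ⟨p, hp, ep⟩ := hword 8
  obtain ⟨q, hq, eq⟩ := hword 12
  have hw' : mask0 = maskL (prodsL (tl x) (tl y) (tl p) (tl q)) := by
    have := Nat.eq_of_beq_eq_true hw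
    rw [hd, ex, ey, ep, eq] at this
    exact this
  have hlevkey : ∀ l ∈ lev 10, ∃ t ∈ prodsL (tl x) (tl y) (tl p) (tl q),
      keyL t.1 t.2 = keyL l idL := by
    intro l hl
    rw [← maskL_bit, ← hw', mask0, maskL_bit]
    exact ⟨(l, idL), List.mem_map.2 ⟨l, hl, rfl⟩, rfl⟩
  have h01 : ∀ l ∈ lev 10, ∃ a b, a < 12 ∧ b < 12 ∧ keyL l idL = a + 12 * (b + 12 * (1 + 12 * 0)) :=
    lev_key
  intro l hl
  obtain ⟨t, ht, hk⟩ := hlevkey l hl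
  simp only [prodsL, List.mem_flatMap, List.mem_map] at ht
  obtain ⟨i, -, j, -, a, -, b, -, rfl⟩ := ht
  simp only [pw_tl, cmp_tl] at hk
  set g := x ^ i * y ^ j * (p ^ a * q ^ b) with hg
  have hgH : g ∈ H := H.mul_mem (H.mul_mem (H.pow_mem hx _) (H.pow_mem hy _))
        (H.mul_mem (H.pow_mem hp _) (H.pow_mem hq _))
  refine ⟨g, hgH, ?_⟩
  have hk2 := hk
  rw [key_tl, ← hg] at hk
  obtain ⟨a', b', ha, hb, hab⟩ := h01 l hl
  rw [hab] at hk
  have l0 := vP_lt g 0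
  have l1 := vP_lt g 1
  have l2 := vP_lt g 2
  have l3 := vP_lt g 3
  have g1 : vP g 1 = 1 := by omega
  have g0 : vP g 0 = 0 := by omega
  have hgl : tl g ∈ lev 10 := tl_mem_lev (hH g hgH) (Fin.ext g0) (Fin.ext g1)
  have : keyL (tl g) idL = keyL l idL := by
    rw [← hk2, ← tl_one, key_tl, key_tl, mul_one]
  exact List.inj_on_of_nodup_map hnd hgl hl this

theorem stab_card (H : Subgroup P12) (hc : cP ∈ H) (u : P12) (hu : u * cP * u ∈ H) (hui : Inv u)
    (hu2 : u * u = 1) (hu1 : u ≠ 1) (hu00 : u 0 = 0) (hu11 : u 1 = 1) (hH : ∀ σ ∈ H, Inv σ) :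
    Nat.card {σ : P12 // σ ∈ H ∧ σ 0 = 0 ∧ σ 1 = 1} = 60 := by
  have hall := stab_all H hc u hu hui hu2 hu1 hu00 hu11 hH
  obtain ⟨hlen, hnd, -⟩ := lev_facts
  have hnd' : (lev 10).Nodup := List.Nodup.of_map _ hnd
  let f : {σ : P12 // σ ∈ H ∧ σ 0 = 0 ∧ σ 1 = 1} → {l // l ∈ (lev 10).toFinset} :=
    fun σ => ⟨tl σ.1, List.mem_toFinset.2 (tl_mem_lev (hH _ σ.2.1) σ.2.2.1 σ.2.2.2)⟩
  have hf : Function.Bijective f := by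
    constructor
    · intro a b h
      exact Subtype.ext (tl_inj (congrArg Subtype.val h))
    · rintro ⟨l, hl⟩
      obtain ⟨σ, hσ, e⟩ := hall l (List.mem_toFinset.1 hl)
      have hl' := List.mem_toFinset.1 hl
      obtain ⟨a', b', ha, hb, hab⟩ := lev_key l hl'
      have hk : keyL (tl σ) (tl 1) = _ := key_tl σ 1
      rw [tl_one, mul_one, e, hab] at hk
      have l0 := vP_lt σ 0
      have l1 := vP_lt σ 1
      have l2 := vP_lt σ 2
      have l3 := vP_lt σ 3
      have g1 : vP σ 1 = 1 := by omega
      have g0 : vP σ 0 = 0 := by omega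
      exact ⟨⟨σ, hσ, Fin.ext g0, Fin.ext g1⟩, Subtype.ext e⟩
  rw [Nat.card_eq_of_bijective f hf, Nat.card_eq_fintype_card, Fintype.card_coe,
    List.toFinset_card_of_nodup hnd', hlen]

theorem card_H (H : Subgroup P12) (hc : cP ∈ H) (u : P12) (hu : u * cP * u ∈ H) (hui : Inv u)
    (hu2 : u * u = 1) (hu1 : u ≠ 1) (hu00 : u 0 = 0) (hu11 : u 1 = 1) (hH : ∀ σ ∈ H, Inv σ)
    (htr : ∀ x y : Fin 12, x ≠ y → ∃ σ ∈ H, σ 0 = x ∧ σ 1 = y) : Nat.card H = 7920 := by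
  have h60 := stab_card H hc u hu hui hu2 hu1 hu00 hu11 hH
  have h1 : Nat.card (MulAction.stabilizer H ((0, 1) : Fin 12 × Fin 12)) = 60 := by
    rw [← h60]
    refine Nat.card_congr ⟨fun σ => ⟨σ.1.1, σ.1.2, ?_⟩, fun σ => ⟨⟨σ.1, σ.2.1⟩, ?_⟩, fun σ => rfl,
      fun σ => rfl⟩
    · have := MulAction.mem_stabilizer_iff.1 σ.2
      exact ⟨congrArg Prod.fst this, congrArg Prod.snd this⟩
    · rw [MulAction.mem_stabilizer_iff]
      exact Prod.ext σ.2.2.1 σ.2.2.2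
  have h2 : MulAction.orbit H ((0, 1) : Fin 12 × Fin 12) =
      ((Finset.univ : Finset (Fin 12)).offDiag : Set (Fin 12 × Fin 12)) := by
    ext ⟨x, y⟩
    rw [Finset.mem_coe, Finset.mem_offDiag]
    constructor
    · rintro ⟨σ, hσ⟩
      refine ⟨Finset.mem_univ _, Finset.mem_univ _, ?_⟩
      have e1 : σ.1 0 = x := congrArg Prod.fst hσ
      have e2 : σ.1 1 = y := congrArg Prod.snd hσ
      rw [← e1, ← e2]
      intro h
      have := σ.1.injective h
      exact absurd this (by decide)
    · rintro ⟨-, -, hxy⟩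
      obtain ⟨σ, hσ, rfl, rfl⟩ := htr x y hxy
      exact ⟨⟨σ, hσ⟩, rfl⟩
  have h3 := Nat.card_congr (MulAction.orbitProdStabilizerEquivGroup H ((0, 1) : Fin 12 × Fin 12))
  rw [Nat.card_prod, h1, h2] at h3
  rw [← h3]
  rw [Nat.card_coe_set_eq, Set.ncard_coe_finset, Finset.offDiag_card]
  rfl

end M11

namespace M11

section lab
variable {G : Type*} [Group G]

theorem zpow_smul_eq_iff {X : Type*} [MulAction G X] (c : G) (hc : c ^ 11 = 1) (x : X)
    (hx : c • x ≠ x) (i j : ℤ) : c ^ i • x = c ^ j • x ↔ (11 : ℤ) ∣ i - j := by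
  have hc' : c ^ (11 : ℤ) = 1 := by exact_mod_cast hc
  constructor
  · intro h
    have h1 : c ^ (i - j) ∈ MulAction.stabilizer G x := by
      rw [MulAction.mem_stabilizer_iff, zpow_sub, ← zpow_neg, ← zpow_add, add_comm, zpow_add,
        mul_smul, h, ← mul_smul, ← zpow_add]
      simp
    by_contra hnd
    have hp : Prime (11 : ℤ) := by
      have : Nat.Prime 11 := by norm_num
      exact Nat.prime_iff_prime_int.1 this
    obtain ⟨a, b, hab⟩ := (hp.coprime_iff_not_dvd.2 hnd)
    apply hx
    rw [← MulAction.mem_stabilizer_iff]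
    have : c = c ^ (a * 11 + b * (i - j)) := by rw [hab, zpow_one]
    rw [this, zpow_add, mul_comm a, zpow_mul, hc', one_zpow, one_mul, mul_comm b, zpow_mul]
    exact Subgroup.zpow_mem _ h1 _
  · rintro ⟨k, hk⟩
    have : i = 11 * k + j := by omega
    rw [this, zpow_add, zpow_mul, hc', one_zpow, one_mul]

theorem lab_inj {X : Type*} [MulAction G X] (c : G) (hc : c ^ 11 = 1) (x : X)
    (hx : c • x ≠ x) : Function.Injective (fun i : Fin 11 => c ^ ((i : ℕ) : ℤ) • x) := by
  intro i j h
  have := (zpow_smul_eq_iff c hc x hx _ _).1 h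
  ext
  omega

theorem lab_T {X : Type*} [MulAction G X] [Finite X] (hX : Nat.card X = 11) (c : G)
    (hc : c ^ 11 = 1) (x : X) (hx : c • x ≠ x) :
    Function.Bijective (fun i : Fin 11 => c ^ ((i : ℕ) : ℤ) • x) :=
  (Nat.bijective_iff_injective_and_card _).2 ⟨lab_inj c hc x hx, by simp [hX]⟩

theorem lab_Ω {X : Type*} [MulAction G X] [Finite X] (hX : Nat.card X = 12) (c : G)
    (hc : c ^ 11 = 1) (x : X) (hx : c • x ≠ x) :
    ∃ y : X, c • y = y ∧ (∀ i : ℤ, c ^ i • x ≠ y) ∧ ∀ z, z ≠ y → ∃ i : Fin 11, z = c ^ ((i : ℕ) : ℤ) • x := by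
  have hinj := lab_inj c hc x hx
  have hr : (Set.range (fun i : Fin 11 => c ^ ((i : ℕ) : ℤ) • x)).ncard = 11 := by
    rw [← Set.image_univ, Set.ncard_image_of_injective _ hinj, Set.ncard_univ]; simp
  have hcpl : (Set.range (fun i : Fin 11 => c ^ ((i : ℕ) : ℤ) • x))ᶜ.ncard = 1 := by
    have := Set.ncard_add_ncard_compl (Set.range (fun i : Fin 11 => c ^ ((i : ℕ) : ℤ) • x))
    omega
  obtain ⟨y, hy⟩ := Set.ncard_eq_one.1 hcpl
  have hmem : ∀ z, (∃ i : Fin 11, c ^ ((i : ℕ) : ℤ) • x = z) ∨ z = y := by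
    intro z
    by_cases h : z ∈ Set.range (fun i : Fin 11 => c ^ ((i : ℕ) : ℤ) • x)
    · left; exact h
    · right
      have : z ∈ (Set.range (fun i : Fin 11 => c ^ ((i : ℕ) : ℤ) • x))ᶜ := h
      rw [hy] at this; exact this
  have hny : ∀ i : ℤ, c ^ i • x ≠ y := by
    intro i h
    have hyy : y ∈ (Set.range (fun i : Fin 11 => c ^ ((i : ℕ) : ℤ) • x))ᶜ := by rw [hy]; rfl
    apply hyy
    refine ⟨⟨(i % 11).toNat, by omega⟩, ?_⟩
    rw [← h]
    apply (zpow_smul_eq_iff c hc x hx _ _).2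
    simp only
    omega
  refine ⟨y, ?_, hny, ?_⟩
  · rcases hmem (c • y) with ⟨i, hi⟩ | h
    · exfalso
      apply hny (((i : ℕ) : ℤ) - 1)
      rw [sub_eq_neg_add, zpow_add, mul_smul, hi, zpow_neg_one, inv_smul_smul]
    · exact h
  · intro z hz
    rcases hmem z with ⟨i, hi⟩ | h
    · exact ⟨i, hi.symm⟩
    · exact absurd h hz
end lab

def qrB (i : Fin 11) : Bool := Nat.testBit 570 i.val

theorem diffset0 : ∀ b0 b1 b2 b3 b4 b5 b6 b7 b8 b9 b10 : Bool,
    Nat.beq (b0.toNat.add (b1.toNat.add (b2.toNat.add (b3.toNat.add (b4.toNat.add (b5.toNat.add (b6.toNat.add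
      (b7.toNat.add (b8.toNat.add (b9.toNat.add b10.toNat)))))))))) 5 = true →
    let δ : Fin 11 → Bool := ![b0, b1, b2, b3, b4, b5, b6, b7, b8, b9, b10]
    (∀ j : Fin 11, j ≠ 0 → (List.finRange 11).countP (fun k => δ (-k) == δ (j - k)) = 5) →
    ∃ b : Fin 11, (∀ i : Fin 11, δ (i + b) = qrB i) ∨ (∀ i : Fin 11, δ (-i + b) = qrB i) := by
  decide +kernel

theorem countP_eq (p : Fin 11 → Bool) :
    (List.finRange 11).countP p = Nat.card {k : Fin 11 // p k = true} := by
  rw [Nat.card_eq_fintype_card, Fintype.card_subtype, List.countP_eq_length_filter,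
    ← List.toFinset_card_of_nodup ((List.nodup_finRange 11).filter _)]
  congr 1
  ext x
  simp

theorem diffset (δ : Fin 11 → Bool) (h1 : Nat.card {k : Fin 11 // δ k = true} = 5)
    (h2 : ∀ j : Fin 11, j ≠ 0 → Nat.card {k : Fin 11 // δ (-k) = δ (j - k)} = 5) :
    ∃ b : Fin 11, (∀ i : Fin 11, δ (i + b) = qrB i) ∨ (∀ i : Fin 11, δ (-i + b) = qrB i) := by
  have hδ : δ = ![δ 0, δ 1, δ 2, δ 3, δ 4, δ 5, δ 6, δ 7, δ 8, δ 9, δ 10] := by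
    funext i; fin_cases i <;> rfl
  have := diffset0 (δ 0) (δ 1) (δ 2) (δ 3) (δ 4) (δ 5) (δ 6) (δ 7) (δ 8) (δ 9) (δ 10)
  rw [← hδ] at this
  apply this
  · have e : (List.finRange 11).countP δ = 5 := by rw [countP_eq, h1]
    rw [Nat.beq_eq, ← e]
    have : ∀ b : Bool, b.toNat = if b = true then 1 else 0 := by decide
    have hf : List.finRange 11 = [0,1,2,3,4,5,6,7,8,9,10] := by decide
    rw [hf]
    simp only [List.countP_cons, List.countP_nil, this, Nat.add_eq]
    omega
  · intro j hj
    rw [countP_eq]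
    simpa using h2 j hj

end M11

set_option linter.unusedSectionVars false
set_option linter.deprecated false
namespace M11

section core
variable {G Ω T : Type*} [Group G] [MulAction G Ω] [MulAction G T] [Finite Ω] [Finite T]

/-- being on the same side of the hexad -/
def RR (β : T → Set Ω) (a b : Ω) (t : T) : Prop := a ∈ β t ↔ b ∈ β t

theorem RR_trans (β : T → Set Ω) (z a b : Ω) (t : T) :
    RR β a b t ↔ (RR β z a t ↔ RR β z b t) := by
  unfold RR; tauto

theorem RR_card (β : T → Set Ω) (hΩ : Nat.card Ω = 12) (h6 : ∀ t, (β t).ncard = 6) (z : Ω) (t : T) :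
    {a | RR β z a t}.ncard = 6 := by
  by_cases h : z ∈ β t
  · have : {a | RR β z a t} = β t := by ext a; simp [RR, h]
    rw [this, h6]
  · have : {a | RR β z a t} = (β t)ᶜ := by ext a; simp [RR, h]
    have h2 := Set.ncard_add_ncard_compl (β t)
    rw [this]; have := h6 t; omega

variable (β : T → Set Ω) (hinv : ∀ (g : G) a b t, RR β (g • a) (g • b) (g • t) ↔ RR β a b t)
include hinv

theorem RR_shift (g : G) (a b : Ω) (t : T) : RR β (g • a) (g • b) t ↔ RR β a b (g⁻¹ • t) := by
  rw [← hinv g a b, smul_inv_smul]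

theorem nn_inv (g : G) (a b : Ω) :
    Nat.card {t // RR β (g • a) (g • b) t} = Nat.card {t // RR β a b t} := by
  symm
  apply Nat.card_congr
  refine (MulAction.toPerm g : Equiv.Perm T).subtypeEquiv ?_
  intro t
  exact (hinv g a b t).symm

theorem n4_inv (g : G) (a b c d : Ω) :
    Nat.card {t // RR β (g • a) (g • b) t ∧ RR β (g • a) (g • c) t ∧ RR β (g • a) (g • d) t} =
    Nat.card {t // RR β a b t ∧ RR β a c t ∧ RR β a d t} := by
  symm
  apply Nat.card_congr
  refine (MulAction.toPerm g : Equiv.Perm T).subtypeEquiv ?_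
  intro t
  rw [← hinv g a b t, ← hinv g a c t, ← hinv g a d t]
  rfl

theorem label (hΩ : Nat.card Ω = 12) (hT : Nat.card T = 11) (h6 : ∀ t, (β t).ncard = 6)
    (c : G) (hc : c ^ 11 = 1) (x : Ω) (hx : c • x ≠ x) (y : Ω) (hcy : c • y = y)
    (hxy : ∀ i : ℤ, c ^ i • x ≠ y) (hall : ∀ z, z ≠ y → ∃ i : Fin 11, z = c ^ ((i : ℕ) : ℤ) • x)
    (h2 : ∀ a b : Ω, a ≠ b → ∃ g : G, g • y = a ∧ g • x = b) :
    ∃ (s : ℤ) (t : T), (s = 1 ∨ s = -1) ∧ (∀ k : ℤ, c ^ k • t = t → (11 : ℤ) ∣ k) ∧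
      ∀ i k : Fin 11, RR β y (c ^ (s * ((i : ℕ) : ℤ)) • x) (c ^ (s * ((k : ℕ) : ℤ)) • t) ↔
        qrB (i - k) = true := by
  have hcz : ∀ k : ℤ, c ^ k • y = y := by
    intro k
    have : c ∈ MulAction.stabilizer G y := hcy
    exact Subgroup.zpow_mem _ this k
  have hsh : ∀ (t : T) (i k : ℤ), RR β y (c ^ i • x) (c ^ k • t) ↔ RR β y (c ^ (i - k) • x) t := by
    intro t i k
    have := hinv (c ^ k) y (c ^ (i - k) • x) t
    rw [hcz, ← mul_smul, ← zpow_add, add_sub_cancel] at this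
    exact this
  -- the set of labels
  have hcard : ∀ t : T, Nat.card {i : Fin 11 // RR β y (c ^ ((i : ℕ) : ℤ) • x) t} = 5 := by
    intro t
    have h := RR_card β hΩ h6 y t
    have e : {a | RR β y a t} = insert y ((fun i : Fin 11 => c ^ ((i : ℕ) : ℤ) • x) ''
        {i : Fin 11 | RR β y (c ^ ((i : ℕ) : ℤ) • x) t}) := by
      ext a
      simp only [Set.mem_setOf_eq, Set.mem_insert_iff, Set.mem_image]
      constructor
      · intro ha
        by_cases hay : a = y
        · left; exact hay
        · right
          obtain ⟨i, hi⟩ := hall a hay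
          exact ⟨i, by rw [← hi]; exact ha, hi.symm⟩
      · rintro (rfl | ⟨i, hi, rfl⟩)
        · exact Iff.rfl
        · exact hi
    rw [e, Set.ncard_insert_of_notMem, Set.ncard_image_of_injective _ (lab_inj c hc x hx)] at h
    · have : Nat.card {i : Fin 11 // RR β y (c ^ ((i : ℕ) : ℤ) • x) t} =
        {i : Fin 11 | RR β y (c ^ ((i : ℕ) : ℤ) • x) t}.ncard := rfl
      omega
    · rintro ⟨i, -, hi⟩
      exact hxy _ hi
  have hper : ∀ (i j : ℤ), (11 : ℤ) ∣ i - j → c ^ i • x = c ^ j • x := fun i j h =>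
    (zpow_smul_eq_iff c hc x hx i j).2 h
  -- c moves every t
  have hmove : ∀ t : T, c • t ≠ t := by
    intro t ht
    have htz : ∀ k : ℤ, c ^ k • t = t := by
      intro k
      have : c ∈ MulAction.stabilizer G t := ht
      exact Subgroup.zpow_mem _ this k
    have h5 := hcard t
    have hconst : ∀ i j : ℤ, RR β y (c ^ i • x) t ↔ RR β y (c ^ j • x) t := by
      intro i j
      have := hsh t i (i - j)
      rw [htz, sub_sub_cancel] at this
      exact this
    by_cases h0 : RR β y (c ^ (0 : ℤ) • x) t
    · have : Nat.card {i : Fin 11 // RR β y (c ^ ((i : ℕ) : ℤ) • x) t} = 11 := by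
        rw [Nat.card_congr (Equiv.subtypeUnivEquiv (fun i => (hconst _ 0).2 h0))]; simp
      omega
    · have : Nat.card {i : Fin 11 // RR β y (c ^ ((i : ℕ) : ℤ) • x) t} = 0 := by
        rw [Nat.card_eq_zero]; left
        exact ⟨fun i => h0 ((hconst _ 0).1 i.2)⟩
      omega
  have hTne : Nonempty T := by
    by_contra h
    rw [not_nonempty_iff] at h
    have : Nat.card T = 0 := Nat.card_of_isEmpty
    omega
  obtain ⟨t0⟩ := hTne
  classical
  let δ : Fin 11 → Bool := fun i => decide (RR β y (c ^ ((i : ℕ) : ℤ) • x) t0)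
  have hδ : ∀ (i : ℤ) (j : Fin 11), (11 : ℤ) ∣ i - ((j : ℕ) : ℤ) →
      (RR β y (c ^ i • x) t0 ↔ δ j = true) := by
    intro i j h
    rw [hper _ _ h]
    simp [δ]
  have hbijT := lab_T hT c hc t0 (hmove t0)
  have h5 : ∀ a b : Ω, a ≠ b → Nat.card {t // RR β a b t} = 5 := by
    intro a b hab
    obtain ⟨g, rfl, rfl⟩ := h2 a b hab
    rw [nn_inv β hinv]
    rw [← hcard t0]
    symm
    let e := Equiv.ofBijective _ hbijT
    apply Nat.card_congr
    refine ((Equiv.neg (Fin 11)).trans e).subtypeEquiv ?_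
    intro i
    show _ ↔ RR β y x (c ^ (((-i : Fin 11) : ℕ) : ℤ) • t0)
    have := hsh t0 0 (((-i : Fin 11) : ℕ) : ℤ)
    rw [zpow_zero, one_smul] at this
    rw [this, hper]
    rw [Fin.val_neg']
    omega
  obtain ⟨b, hb⟩ := diffset δ (by
      rw [← hcard t0]
      apply Nat.card_congr
      refine (Equiv.refl _).subtypeEquiv ?_
      intro i; simp [δ]) (by
      intro j hj
      rw [← h5 x (c ^ ((j : ℕ) : ℤ) • x) (by
        intro h
        have := (zpow_smul_eq_iff c hc x hx 0 ((j : ℕ) : ℤ)).1 (by simpa using h)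
        apply hj; ext; simp; omega)]
      let e := Equiv.ofBijective _ hbijT
      apply Nat.card_congr
      refine e.subtypeEquiv ?_
      intro k
      show _ ↔ RR β x (c ^ ((j : ℕ) : ℤ) • x) (c ^ ((k : ℕ) : ℤ) • t0)
      rw [RR_trans β y]
      have e1 := hsh t0 0 ((k : ℕ) : ℤ)
      rw [zpow_zero, one_smul] at e1
      rw [e1, hsh, hδ _ (-k) (by rw [Fin.val_neg']; omega),
        hδ _ (j - k) (by rw [Fin.sub_def]; simp only; omega)]
      rw [Bool.eq_iff_iff])
  have hst : ∀ m : ℤ, ∀ k : ℤ, c ^ k • (c ^ m • t0) = c ^ m • t0 → (11 : ℤ) ∣ k := by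
    intro m k h
    rw [← mul_smul, ← zpow_add] at h
    have := (zpow_smul_eq_iff c hc t0 (hmove t0) _ _).1 h
    simpa using this
  rcases hb with hb | hb
  · refine ⟨1, c ^ (-((b : ℕ) : ℤ)) • t0, Or.inl rfl, hst _, ?_⟩
    intro i k
    rw [← hb, ← mul_smul, ← zpow_add, hsh, hδ]
    rw [Fin.val_add, Fin.sub_def]
    simp only
    omega
  · refine ⟨-1, c ^ (-((b : ℕ) : ℤ)) • t0, Or.inr rfl, hst _, ?_⟩
    intro i k
    rw [← hb, ← mul_smul, ← zpow_add, hsh, hδ]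
    rw [Fin.val_add, Fin.val_neg', Fin.sub_def]
    simp only
    omega
end core
end M11

set_option linter.unusedSectionVars false
namespace M11

theorem bt_bool (n k : ℕ) : bt n k = (n.testBit k).toNat := by
  have : bt n k = (n >>> k) &&& 1 := rfl
  rw [this, Nat.testBit, Nat.and_comm (n >>> k) 1]
  have h : ∀ m : ℕ, 1 &&& m = m % 2 := by intro m; rw [Nat.and_comm, Nat.and_one_is_mod]
  rw [h]
  have : (n >>> k) % 2 = 0 ∨ (n >>> k) % 2 = 1 := by omega
  rcases this with h | h <;> rw [h] <;> rfl

theorem pc_card (n : ℕ) : pc n = Nat.card {k : Fin 11 // n.testBit k = true} := by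
  rw [← countP_eq]
  have hf : List.finRange 11 = [0,1,2,3,4,5,6,7,8,9,10] := by decide
  have : ∀ b : Bool, b.toNat = if b = true then 1 else 0 := by decide
  rw [hf]
  simp only [List.countP_cons, List.countP_nil, pc, bt_bool, Nat.add_eq, this]
  have e : ∀ m : Fin 11, ∀ k : ℕ, (m : ℕ) = k → n.testBit (m : ℕ) = n.testBit k := by
    rintro m k rfl; rfl
  rw [e 0 0 rfl, e 1 1 rfl, e 2 2 rfl, e 3 3 rfl, e 4 4 rfl, e 5 5 rfl, e 6 6 rfl, e 7 7 rfl,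
    e 8 8 rfl, e 9 9 rfl, e 10 10 rfl]
  omega

def rB (x : Fin 12) (k : Fin 11) : Bool := (rw x).testBit k

theorem N4_card (x y z w : Fin 12) : N4 x y z w =
    Nat.card {k : Fin 11 // rB x k = rB y k ∧ rB x k = rB z k ∧ rB x k = rB w k} := by
  unfold N4
  rw [pc_card]
  apply Nat.card_congr
  refine (Equiv.refl _).subtypeEquiv ?_
  intro k
  have h : ∀ a b c : ℕ, Nat.testBit (Nat.xor 2047 (Nat.lor a (Nat.lor b c))) k =
      (true ^^ (a.testBit k || (b.testBit k || c.testBit k))) := by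
    intro a b c
    show Nat.testBit (2047 ^^^ (a ||| (b ||| c))) k = _
    rw [Nat.testBit_xor, Nat.testBit_or, Nat.testBit_or]
    congr 1
    revert k; decide
  rw [h]
  have h' : ∀ a b : ℕ, Nat.testBit (Nat.xor a b) k = (a.testBit k ^^ b.testBit k) :=
    fun a b => Nat.testBit_xor a b k
  rw [h', h', h']
  show _ ↔ rB x k = rB y k ∧ rB x k = rB z k ∧ rB x k = rB w k
  change (true ^^ ((rB x k ^^ rB y k) || ((rB x k ^^ rB z k) || (rB x k ^^ rB w k)))) = true ↔ _
  cases rB x k <;> cases rB y k <;> cases rB z k <;> cases rB w k <;> decide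

theorem rB_succ : ∀ i k : Fin 11, rB i.succ k = qrB (i - k) := by decide +kernel
theorem rB_zero : ∀ k : Fin 11, rB 0 k = true := by decide +kernel

section core
variable {G Ω T : Type*} [Group G] [MulAction G Ω] [MulAction G T] [Finite Ω] [Finite T]
  [FaithfulSMul G Ω] [Finite G]

theorem two_trans (N : Subgroup G) (hfix : ∀ a : Ω, ∃ n ∈ N, n • a ≠ a) (c : G) (hcN : c ∈ N)
    (x y : Ω) (hcy : c • y = y)
    (hall : ∀ z, z ≠ y → ∃ i : Fin 11, z = c ^ ((i : ℕ) : ℤ) • x) :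
    ∀ a b : Ω, a ≠ b → ∃ g ∈ N, g • y = a ∧ g • x = b := by
  have h1 : ∀ a, ∃ g ∈ N, g • y = a := by
    intro a
    by_cases hay : a = y
    · exact ⟨1, N.one_mem, by simp [hay]⟩
    · obtain ⟨n, hn, hny⟩ := hfix y
      obtain ⟨i, hi⟩ := hall _ hny
      obtain ⟨j, hj⟩ := hall _ hay
      refine ⟨c ^ ((j : ℕ) : ℤ) * (c ^ ((i : ℕ) : ℤ))⁻¹ * n,
        N.mul_mem (N.mul_mem (N.zpow_mem hcN _) (N.inv_mem (N.zpow_mem hcN _))) hn, ?_⟩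
      rw [mul_smul, mul_smul, hi, inv_smul_smul, hj]
  intro a b hab
  obtain ⟨n, hn, rfl⟩ := h1 a
  have hb : n⁻¹ • b ≠ y := by
    intro h; apply hab; rw [← h, smul_inv_smul]
  obtain ⟨j, hj⟩ := hall _ hb
  have hcz : ∀ k : ℤ, c ^ k • y = y := by
    intro k
    have : c ∈ MulAction.stabilizer G y := hcy
    exact Subgroup.zpow_mem _ this k
  refine ⟨n * c ^ ((j : ℕ) : ℤ), N.mul_mem hn (N.zpow_mem hcN _), ?_, ?_⟩
  · rw [mul_smul, hcz]
  · rw [mul_smul, ← hj, smul_inv_smul]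

theorem core_card (β : T → Set Ω) (hinv : ∀ (g : G) a b t, RR β (g • a) (g • b) (g • t) ↔ RR β a b t)
    (hΩ : Nat.card Ω = 12) (hT : Nat.card T = 11) (h6 : ∀ t, (β t).ncard = 6)
    (N : Subgroup G) (hN : N.Normal) (h11 : 11 ∣ Nat.card N) (hfix : ∀ a : Ω, ∃ n ∈ N, n • a ≠ a)
    (τ : G) (hτ1 : τ ≠ 1) (hτ2 : τ * τ = 1) (p q : Ω) (hpq : p ≠ q) (hp : τ • p = p) (hq : τ • q = q) :
    Nat.card N = 7920 := by
  have : Fact (Nat.Prime 11) := ⟨by norm_num⟩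
  obtain ⟨⟨c0, hc0N⟩, hc0o⟩ := exists_prime_orderOf_dvd_card' 11 h11
  have hc0 : c0 ^ 11 = 1 := by
    have := pow_orderOf_eq_one (⟨c0, hc0N⟩ : N)
    rw [hc0o] at this
    exact congrArg Subtype.val this
  have hc01 : c0 ≠ 1 := by
    rintro rfl
    have : orderOf (⟨1, hc0N⟩ : N) = 1 := orderOf_eq_one_iff.2 rfl
    omega
  obtain ⟨x, hx⟩ : ∃ x : Ω, c0 • x ≠ x := by
    by_contra h
    push Not at h
    apply hc01
    apply FaithfulSMul.eq_of_smul_eq_smul (α := Ω)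
    intro a; rw [h a, one_smul]
  obtain ⟨y, hcy, hxy, hall⟩ := lab_Ω hΩ c0 hc0 x hx
  have h2N := two_trans N hfix c0 hc0N x y hcy hall
  obtain ⟨s, t, hs, hst, hlab⟩ := label β hinv hΩ hT h6 c0 hc0 x hx y hcy hxy hall
    (fun a b hab => (h2N a b hab).imp fun g hg => hg.2)
  -- the new generator
  obtain ⟨c, hc_def⟩ : ∃ c, c = c0 ^ s := ⟨_, rfl⟩
  have hcN : c ∈ N := by rw [hc_def]; exact N.zpow_mem hc0N _
  have hc : c ^ 11 = 1 := by
    rw [hc_def, ← zpow_natCast, ← zpow_mul, mul_comm, zpow_mul, zpow_natCast, hc0, one_zpow]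
  have hcx : c • x ≠ x := by
    intro h
    have : c0 ^ s • x = c0 ^ (0 : ℤ) • x := by rw [← hc_def, h]; simp
    rw [zpow_smul_eq_iff c0 hc0 x hx] at this
    omega
  have hcyy : c • y = y := by
    rw [hc_def]
    have : c0 ∈ MulAction.stabilizer G y := hcy
    exact Subgroup.zpow_mem _ this s
  have hcxy : ∀ i : ℤ, c ^ i • x ≠ y := by
    intro i; rw [hc_def, ← zpow_mul]; exact hxy _
  have hct : c • t ≠ t := by
    intro h
    rw [hc_def] at h
    have := hst s h
    omega
  have hlab' : ∀ i k : Fin 11, RR β y (c ^ ((i : ℕ) : ℤ) • x) (c ^ ((k : ℕ) : ℤ) • t) ↔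
      qrB (i - k) = true := by
    intro i k
    rw [hc_def, ← zpow_mul, ← zpow_mul]
    exact hlab i k
  -- the labelling
  let F : Fin 12 → Ω := Fin.cons y (fun i : Fin 11 => c ^ ((i : ℕ) : ℤ) • x)
  have hF0 : F 0 = y := rfl
  have hFs : ∀ i : Fin 11, F i.succ = c ^ ((i : ℕ) : ℤ) • x := fun i => rfl
  have hFb : Function.Bijective F := by
    refine (Nat.bijective_iff_injective_and_card _).2 ⟨?_, by simp [hΩ]⟩
    rw [Fin.cons_injective_iff]
    refine ⟨?_, lab_inj c hc x hcx⟩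
    rintro ⟨i, hi⟩
    exact hcxy _ hi
  have hTb := lab_T hT c hc t hct
  let e : Fin 12 ≃ Ω := Equiv.ofBijective F hFb
  let eT : Fin 11 ≃ T := Equiv.ofBijective _ hTb
  have hR0 : ∀ (a : Fin 12) (k : Fin 11), RR β y (e a) (eT k) ↔ rB a k = true := by
    intro a k
    refine Fin.cases ?_ (fun i => ?_) a
    · rw [rB_zero]
      exact ⟨fun _ => rfl, fun _ => Iff.rfl⟩
    · rw [rB_succ]
      exact hlab' i k
  have hR : ∀ (a b : Fin 12) (k : Fin 11), RR β (e a) (e b) (eT k) ↔ rB a k = rB b k := by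
    intro a b k
    rw [RR_trans β y, hR0, hR0]
    cases rB a k <;> cases rB b k <;> simp
  have hN4 : ∀ a b c d : Fin 12, N4 a b c d =
      Nat.card {t // RR β (e a) (e b) t ∧ RR β (e a) (e c) t ∧ RR β (e a) (e d) t} := by
    intro a b c d
    rw [N4_card]
    apply Nat.card_congr
    refine eT.subtypeEquiv ?_
    intro k
    rw [hR, hR, hR]
  let φ : G →* P12 := (e.symm.permCongrHom.toMonoidHom).comp (MulAction.toPermHom G Ω)
  have hφ : ∀ g a, e (φ g a) = g • e a := by
    intro g a
    change e (e.symm (g • e.symm.symm a)) = g • e a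
    rw [Equiv.apply_symm_apply, Equiv.symm_symm]
  have hφi : Function.Injective φ := by
    intro g h hgh
    apply FaithfulSMul.eq_of_smul_eq_smul (α := Ω)
    intro a
    have h1 := hφ g (e.symm a)
    have h2 := hφ h (e.symm a)
    rw [hgh, h2] at h1
    simpa using h1.symm
  have hInv : ∀ g, Inv (φ g) := by
    intro g a b c d
    rw [hN4, hN4, hφ, hφ, hφ, hφ]
    exact n4_inv β hinv g _ _ _ _
  have hφc : φ c = cP := by
    ext1 a
    apply e.injective
    rw [hφ]
    refine Fin.cases ?_ (fun i => ?_) a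
    · exact hcyy
    · show c • (c ^ ((i : ℕ) : ℤ) • x) = F (cFun i.succ)
      rw [← mul_smul, ← zpow_one_add]
      by_cases hi : i = 10
      · subst hi
        have : cFun (Fin.succ 10) = Fin.succ 0 := by decide
        rw [this, hFs]
        apply (zpow_smul_eq_iff c hc x hcx _ _).2
        decide
      · have : cFun (Fin.succ i) = Fin.succ (i + 1) := by revert i; decide
        rw [this, hFs]
        congr 2
        have : ((i + 1 : Fin 11) : ℕ) = i + 1 := by revert i; decide
        rw [this]; push_cast; ring
  -- the involution
  have hx1 : e 1 = x := by
    have : e 1 = F (Fin.succ 0) := rfl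
    rw [this, hFs]; simp
  have hx0 : e 0 = y := rfl
  obtain ⟨n, hnN, hny, hnx⟩ := h2N p q hpq
  have hu : φ (n⁻¹ * τ * n) * cP * φ (n⁻¹ * τ * n) ∈ N.map φ := by
    rw [← hφc, ← map_mul, ← map_mul]
    apply Subgroup.mem_map_of_mem
    have : n⁻¹ * τ * n = (n⁻¹ * τ * n)⁻¹ := by
      rw [eq_inv_iff_mul_eq_one]
      calc n⁻¹ * τ * n * (n⁻¹ * τ * n) = n⁻¹ * (τ * τ) * n := by group
        _ = 1 := by rw [hτ2]; group
    nth_rewrite 2 [this]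
    exact hN.conj_mem c hcN _
  have hfinal := card_H (N.map φ) (by rw [← hφc]; exact Subgroup.mem_map_of_mem _ hcN)
    (φ (n⁻¹ * τ * n)) hu (hInv _) (by
      rw [← map_mul, ← map_one φ]; congr 1
      calc n⁻¹ * τ * n * (n⁻¹ * τ * n) = n⁻¹ * (τ * τ) * n := by group
        _ = 1 := by rw [hτ2]; group) (by
      intro h
      rw [← map_one φ] at h
      have := hφi h
      apply hτ1
      calc τ = n * (n⁻¹ * τ * n) * n⁻¹ := by group
        _ = 1 := by rw [this]; group) (by
      apply e.injective
      rw [hφ, hx0, mul_smul, mul_smul, hny, hp, ← hny, inv_smul_smul]) (by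
      apply e.injective
      rw [hφ, hx1, mul_smul, mul_smul, hnx, hq, ← hnx, inv_smul_smul]) (by
      rintro _ ⟨g, -, rfl⟩; exact hInv g) (by
      intro a b hab
      obtain ⟨g, hg, h1, h2⟩ := h2N (e a) (e b) (fun h => hab (e.injective h))
      refine ⟨φ g, Subgroup.mem_map_of_mem _ hg, ?_, ?_⟩
      · apply e.injective; rw [hφ, hx0, h1]
      · apply e.injective; rw [hφ, hx1, h2])
  rw [← hfinal]
  exact Nat.card_congr (N.equivMapOfInjective φ hφi).toEquiv

theorem dvd_of_trans (N : Subgroup G) (hT : Nat.card T = 11) (h : ∀ s t : T, ∃ g ∈ N, g • s = t) :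
    11 ∣ Nat.card N := by
  have hne : Nonempty T := by
    by_contra h
    rw [not_nonempty_iff] at h
    have : Nat.card T = 0 := Nat.card_of_isEmpty
    omega
  obtain ⟨t⟩ := hne
  have h3 := Nat.card_congr (MulAction.orbitProdStabilizerEquivGroup N t)
  have h4 : MulAction.orbit N t = Set.univ := by
    ext s
    simp only [Set.mem_univ, iff_true]
    obtain ⟨g, hg, e⟩ := h t s
    exact ⟨⟨g, hg⟩, e⟩
  rw [Nat.card_prod, h4, Nat.card_coe_set_eq, Set.ncard_univ, hT] at h3
  exact ⟨_, h3.symm⟩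

theorem core_main (β : T → Set Ω) (hinv : ∀ (g : G) a b t, RR β (g • a) (g • b) (g • t) ↔ RR β a b t)
    (hΩ : Nat.card Ω = 12) (hT : Nat.card T = 11) (h6 : ∀ t, (β t).ncard = 6)
    (htr : ∀ s t : T, ∃ g : G, g • s = t)
    (hfix : ∀ a : Ω, ∃ n : G, n • a ≠ a)
    (τ : G) (hτ1 : τ ≠ 1) (hτ2 : τ * τ = 1) (p q : Ω) (hpq : p ≠ q) (hp : τ • p = p) (hq : τ • q = q) :
    (∀ a b : Ω, ∃ g : G, g • a = b) ∧ IsSimpleGroup G ∧ Nat.card G = 7920 := by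
  have hpt : MulAction.IsPretransitive G T := ⟨htr⟩
  have hne : Nonempty T := by
    by_contra h
    rw [not_nonempty_iff] at h
    have : Nat.card T = 0 := Nat.card_of_isEmpty
    omega
  have hpr : MulAction.IsPreprimitive G T := by
    apply MulAction.IsPreprimitive.of_prime_card
    rw [hT]; norm_num
  have h11 : 11 ∣ Nat.card (⊤ : Subgroup G) :=
    dvd_of_trans (T := T) ⊤ hT (fun s t => (htr s t).imp fun g hg => ⟨trivial, hg⟩)
  have hcardT := core_card β hinv hΩ hT h6 ⊤ inferInstance h11
    (fun a => (hfix a).imp fun g hg => ⟨trivial, hg⟩) τ hτ1 hτ2 p q hpq hp hq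
  have hcard : Nat.card G = 7920 := by
    rw [← hcardT]; exact (Nat.card_congr Subgroup.topEquiv.toEquiv).symm
  have : Fact (Nat.Prime 11) := ⟨by norm_num⟩
  have h11G : 11 ∣ Nat.card G := by rw [hcard]; decide
  obtain ⟨c, hco⟩ := exists_prime_orderOf_dvd_card' 11 h11G
  have hc : c ^ 11 = 1 := by rw [← hco]; exact pow_orderOf_eq_one c
  have hc1 : c ≠ 1 := by
    rintro rfl
    rw [orderOf_one] at hco
    omega
  obtain ⟨x, hx⟩ : ∃ x : Ω, c • x ≠ x := by
    by_contra h
    push Not at h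
    apply hc1
    apply FaithfulSMul.eq_of_smul_eq_smul (α := Ω)
    intro a; rw [h a, one_smul]
  obtain ⟨y, hcy, hxy, hall⟩ := lab_Ω hΩ c hc x hx
  have h2 := two_trans (⊤ : Subgroup G) (fun a => (hfix a).imp fun g hg => ⟨trivial, hg⟩) c trivial
    x y hcy hall
  have hcz : ∀ k : ℤ, c ^ k • y = y := by
    intro k
    have : c ∈ MulAction.stabilizer G y := hcy
    exact Subgroup.zpow_mem _ this k
  have h1 : ∀ a b : Ω, ∃ g : G, g • a = b := by
    intro a b
    by_cases hab : a = b
    · exact ⟨1, by simp [hab]⟩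
    have hy : ∀ a : Ω, ∃ g : G, g • y = a := by
      intro a
      by_cases hax : a = y
      · exact ⟨1, by simp [hax]⟩
      · obtain ⟨g, -, h, -⟩ := h2 a y hax
        exact ⟨g, h⟩
    obtain ⟨g, rfl⟩ := hy a
    obtain ⟨h, rfl⟩ := hy b
    exact ⟨h * g⁻¹, by rw [mul_smul, inv_smul_smul]⟩
  -- separation
  have hsep : ∀ a b : Ω, a ≠ b → ∃ t, ¬ RR β a b t := by
    by_contra hcon
    push Not at hcon
    obtain ⟨a, b, hab, hR⟩ := hcon
    obtain ⟨t⟩ := hne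
    obtain ⟨g, -, rfl, rfl⟩ := h2 a b hab
    have hxyR : ∀ t, RR β y x t := fun t => (hinv g y x t).1 (hR _)
    have hyR : ∀ z, RR β y z t := by
      intro z
      by_cases hz : z = y
      · rw [hz]; exact Iff.rfl
      · obtain ⟨i, rfl⟩ := hall z hz
        have := (hinv (c ^ ((i : ℕ) : ℤ)) y x ((c ^ ((i : ℕ) : ℤ))⁻¹ • t)).2 (hxyR _)
        rw [hcz, smul_inv_smul] at this
        exact this
    have := RR_card β hΩ h6 y t
    have e : {a | RR β y a t} = Set.univ := by ext z; simp [hyR z]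
    rw [e, Set.ncard_univ, hΩ] at this
    omega
  -- a normal subgroup without trivial action is transitive
  have hnfix : ∀ N : Subgroup G, N.Normal → N ≠ ⊥ → ∀ a : Ω, ∃ n ∈ N, n • a ≠ a := by
    intro N hN hNb a
    by_contra hcon
    push Not at hcon
    apply hNb
    rw [Subgroup.eq_bot_iff_forall]
    intro n hn
    apply FaithfulSMul.eq_of_smul_eq_smul (α := Ω)
    intro b
    obtain ⟨g, rfl⟩ := h1 a b
    have := hcon (g⁻¹ * n * g) (by simpa using hN.conj_mem n hn g⁻¹)
    rw [one_smul]
    rw [mul_smul, mul_smul, inv_smul_eq_iff] at this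
    exact this
  have hKer : ∀ N : Subgroup G, N.Normal → (∀ n ∈ N, ∀ t : T, n • t = t) → N = ⊥ := by
    intro N hN hNt
    by_contra hNb
    have hsq : ∀ n ∈ N, n * n = 1 := by
      intro n hn
      apply FaithfulSMul.eq_of_smul_eq_smul (α := Ω)
      intro a
      rw [one_smul]
      by_contra hne'
      obtain ⟨t, ht⟩ := hsep _ _ hne'
      apply ht
      have h := hinv n (n • a) a t
      rw [hNt n hn t] at h
      have h' := RR_trans β (n • a) ((n * n) • a) a t
      rw [mul_smul] at h'
      rw [mul_smul, h']
      clear h' ht hinv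
      unfold RR at h ⊢
      tauto
    have hf := hnfix N hN hNb y
    have htrN : ∀ b, ∃ n ∈ N, n • y = b := by
      intro b
      by_cases hb : b = y
      · exact ⟨1, N.one_mem, by simp [hb]⟩
      obtain ⟨n, hn, hny⟩ := hf
      obtain ⟨i, hi⟩ := hall _ hny
      obtain ⟨j, hj⟩ := hall _ hb
      refine ⟨c ^ (((j : ℕ) : ℤ) - ((i : ℕ) : ℤ)) * n * (c ^ (((j : ℕ) : ℤ) - ((i : ℕ) : ℤ)))⁻¹,
        hN.conj_mem n hn _, ?_⟩
      rw [mul_smul, mul_smul, ← zpow_neg, hcz, hi, hj, ← mul_smul, ← zpow_add, sub_add_cancel]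
    have h3 := Nat.card_congr (MulAction.orbitProdStabilizerEquivGroup N y)
    have h4 : MulAction.orbit N y = Set.univ := by
      ext s
      simp only [Set.mem_univ, iff_true]
      obtain ⟨g, hg, e⟩ := htrN s
      exact ⟨⟨g, hg⟩, e⟩
    rw [Nat.card_prod, h4, Nat.card_coe_set_eq, Set.ncard_univ, hΩ] at h3
    have h3N : 3 ∣ Nat.card N := ⟨4 * _, by rw [← h3]; ring⟩
    have : Fact (Nat.Prime 3) := ⟨by norm_num⟩
    obtain ⟨⟨k, hk⟩, hko⟩ := exists_prime_orderOf_dvd_card' 3 h3N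
    have : orderOf (⟨k, hk⟩ : N) ∣ 2 := by
      apply orderOf_dvd_of_pow_eq_one
      apply Subtype.ext
      simpa [pow_two] using hsq k hk
    rw [hko] at this
    omega
  refine ⟨h1, ?_, hcard⟩
  have hnt : Nontrivial G := ⟨c, 1, hc1⟩
  refine ⟨fun N hN => ?_⟩
  by_cases hNb : N = ⊥
  · left; exact hNb
  right
  have hNT : MulAction.fixedPoints N T ≠ Set.univ := by
    intro h
    apply hNb
    apply hKer N hN
    intro n hn t
    have : t ∈ MulAction.fixedPoints N T := by rw [h]; trivial
    exact this ⟨n, hn⟩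
  have htrN : MulAction.IsPretransitive N T :=
    MulAction.IsQuasiPreprimitive.isPretransitive_of_normal hNT
  have hN11 : 11 ∣ Nat.card N := dvd_of_trans (T := T) N hT (fun s t => by
    obtain ⟨g, hg⟩ := MulAction.exists_smul_eq N s t
    exact ⟨g.1, g.2, hg⟩)
  have := core_card β hinv hΩ hT h6 N hN hN11 (hnfix N hN hNb) τ hτ1 hτ2 p q hpq hp hq
  exact Subgroup.eq_top_of_card_eq N (by rw [this, hcard])
end core
end M11

namespace M11

section lists
variable {R : Type*} [CommRing R]

/-- Horner evaluation of an integer coefficient list -/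
def ev (x : R) : List ℤ → R
  | [] => 0
  | a :: l => (a : R) + x * ev x l

/-- same, with coefficients reduced modulo `p` (`p = 0`: no reduction) -/
def addL (p : ℤ) : List ℤ → List ℤ → List ℤ
  | [], m => m
  | a :: l, [] => a :: l
  | a :: l, b :: m => ((a + b) % p) :: addL p l m

def smulL (p c : ℤ) : List ℤ → List ℤ
  | [] => []
  | a :: l => ((c * a) % p) :: smulL p c l

def mulL (p : ℤ) : List ℤ → List ℤ → List ℤ
  | [], _ => []
  | a :: l, m => addL p (smulL p a m) (0 :: mulL p l m)

/-- multiplication by `x` modulo `x ^ n + gl` -/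
def redX (p : ℤ) (n : ℕ) (gl : List ℤ) (r : List ℤ) : List ℤ :=
  bif r.length == n then addL p (0 :: r.dropLast) (smulL p (-(r.getLastD 0)) gl) else 0 :: r

def mulM (p : ℤ) (n : ℕ) (gl : List ℤ) : List ℤ → List ℤ → List ℤ
  | [], _ => []
  | a :: l, m => addL p (smulL p a m) (redX p n gl (mulM p n gl l m))

def isZ : List ℤ → Bool
  | [] => true
  | a :: l => (a == 0) && isZ l

theorem ev_mod {p : ℤ} (hp : (p : R) = 0) (a : ℤ) : ((a % p : ℤ) : R) = a := by
  rw [Int.emod_def]; push_cast; rw [hp]; ring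

theorem ev_addL {p : ℤ} (hp : (p : R) = 0) (x : R) (l m : List ℤ) :
    ev x (addL p l m) = ev x l + ev x m := by
  induction l generalizing m with
  | nil => simp [addL, ev]
  | cons a l ih =>
    cases m with
    | nil => simp [addL, ev]
    | cons b m =>
      simp only [addL, ev, ih, ev_mod hp]
      push_cast; ring

theorem ev_smulL {p : ℤ} (hp : (p : R) = 0) (x : R) (c : ℤ) (l : List ℤ) :
    ev x (smulL p c l) = c * ev x l := by
  induction l with
  | nil => simp [smulL, ev]
  | cons a l ih =>
    simp only [smulL, ev, ih, ev_mod hp]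
    push_cast; ring

theorem ev_mulL {p : ℤ} (hp : (p : R) = 0) (x : R) (l m : List ℤ) :
    ev x (mulL p l m) = ev x l * ev x m := by
  induction l with
  | nil => simp [mulL, ev]
  | cons a l ih =>
    simp only [mulL, ev, ev_addL hp, ev_smulL hp, ih]
    push_cast; ring

theorem ev_append (x : R) (l m : List ℤ) : ev x (l ++ m) = ev x l + x ^ l.length * ev x m := by
  induction l with
  | nil => simp [ev]
  | cons a l ih =>
    simp only [List.cons_append, ev, ih, List.length_cons, pow_succ]
    ring

theorem ev_redX {p : ℤ} (hp : (p : R) = 0) (x : R) (n : ℕ) (gl : List ℤ)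
    (hg : x ^ n + ev x gl = 0) (r : List ℤ) : ev x (redX p n gl r) = x * ev x r := by
  unfold redX
  rcases h : (r.length == n) with _ | _
  · simp [ev]
  · have hn : r.length = n := by simpa using h
    simp only [cond_true, ev_addL hp, ev_smulL hp, ev]
    rcases List.eq_nil_or_concat r with rfl | ⟨l, a, rfl⟩
    · simp [ev]
    · simp only [List.concat_eq_append] at hn ⊢
      have hx : x * x ^ l.length = - ev x gl := by
        rw [← pow_succ']
        have : l.length + 1 = n := by simpa using hn
        rw [this]; exact eq_neg_of_add_eq_zero_left hg
      rw [List.dropLast_concat, ev_append]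
      simp only [List.getLastD_concat, ev]
      push_cast
      linear_combination (-(a : R)) * hx

theorem ev_mulM {p : ℤ} (hp : (p : R) = 0) (x : R) (n : ℕ) (gl : List ℤ)
    (hg : x ^ n + ev x gl = 0) (l m : List ℤ) :
    ev x (mulM p n gl l m) = ev x l * ev x m := by
  induction l with
  | nil => simp [mulM, ev]
  | cons a l ih =>
    simp only [mulM, ev, ev_addL hp, ev_smulL hp, ev_redX hp x n gl hg, ih]
    ring

theorem ev_isZ (x : R) (l : List ℤ) (h : isZ l = true) : ev x l = 0 := by
  induction l with
  | nil => rfl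
  | cons a l ih =>
    simp only [isZ, Bool.and_eq_true, beq_iff_eq] at h
    simp [ev, h.1, ih h.2]

/-- bivariate -/
def ev2 (x z : R) : List (List ℤ) → R
  | [] => 0
  | a :: l => ev z a + x * ev2 x z l

def add2 : List (List ℤ) → List (List ℤ) → List (List ℤ)
  | [], m => m
  | a :: l, [] => a :: l
  | a :: l, b :: m => addL 0 a b :: add2 l m

def smul2 (n : ℕ) (gl c : List ℤ) : List (List ℤ) → List (List ℤ)
  | [] => []
  | a :: l => mulM 0 n gl c a :: smul2 n gl c l

def mul2 (n : ℕ) (gl : List ℤ) : List (List ℤ) → List (List ℤ) → List (List ℤ)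
  | [], _ => []
  | a :: l, m => add2 (smul2 n gl a m) ([] :: mul2 n gl l m)

def isZ2 : List (List ℤ) → Bool
  | [] => true
  | a :: l => isZ a && isZ2 l

theorem ev2_add2 (x z : R) (l m : List (List ℤ)) : ev2 x z (add2 l m) = ev2 x z l + ev2 x z m := by
  induction l generalizing m with
  | nil => simp [add2, ev2]
  | cons a l ih =>
    cases m with
    | nil => simp [add2, ev2]
    | cons b m =>
      simp only [add2, ev2, ih, ev_addL (R := R) (p := 0) Int.cast_zero]
      ring

theorem ev2_smul2 (x z : R) (n : ℕ) (gl : List ℤ) (hg : z ^ n + ev z gl = 0) (c : List ℤ)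
    (l : List (List ℤ)) : ev2 x z (smul2 n gl c l) = ev z c * ev2 x z l := by
  induction l with
  | nil => simp [smul2, ev2]
  | cons a l ih =>
    simp only [smul2, ev2, ih, ev_mulM (R := R) (p := 0) Int.cast_zero z n gl hg]
    ring

theorem ev2_mul2 (x z : R) (n : ℕ) (gl : List ℤ) (hg : z ^ n + ev z gl = 0)
    (l m : List (List ℤ)) : ev2 x z (mul2 n gl l m) = ev2 x z l * ev2 x z m := by
  induction l with
  | nil => simp [mul2, ev2]
  | cons a l ih =>
    simp only [mul2, ev2, ev2_add2, ev2_smul2 x z n gl hg, ih, ev]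
    ring

theorem ev2_isZ2 (x z : R) (l : List (List ℤ)) (h : isZ2 l = true) : ev2 x z l = 0 := by
  induction l with
  | nil => rfl
  | cons a l ih =>
    simp only [isZ2, Bool.and_eq_true] at h
    simp [ev2, ev_isZ z a h.1, ih h.2]

/-- the polynomial with given coefficient list -/
noncomputable def pol (R : Type*) [CommRing R] (l : List ℤ) : R[X] := ev (Polynomial.X) l

theorem ev_map {S : Type*} [CommRing S] (f : R →+* S) (x : R) (l : List ℤ) :
    f (ev x l) = ev (f x) l := by
  induction l with
  | nil => simp [ev]
  | cons a l ih => simp [ev, ih]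

theorem ev2_map {S : Type*} [CommRing S] (f : R →+* S) (x z : R) (l : List (List ℤ)) :
    f (ev2 x z l) = ev2 (f x) (f z) l := by
  induction l with
  | nil => simp [ev2]
  | cons a l ih => simp [ev2, ih, ev_map]

theorem pol_eval {A : Type*} [CommRing A] [Algebra R A] (x : A) (l : List ℤ) :
    aeval x (pol R l) = ev x l := by
  have := ev_map (Polynomial.aeval x : R[X] →ₐ[R] A).toRingHom Polynomial.X l
  simpa [pol] using this

theorem pol_map {S : Type*} [CommRing S] (f : R →+* S) (l : List ℤ) :
    (pol R l).map f = pol S l := by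
  have := ev_map (Polynomial.mapRingHom f) Polynomial.X l
  simpa [pol] using this

theorem pol_coeff (l : List ℤ) (n : ℕ) : (pol R l).coeff n = ((l.getD n 0 : ℤ) : R) := by
  induction l generalizing n with
  | nil => simp [pol, ev]
  | cons a l ih =>
    have h : pol R (a :: l) = C (a : R) + X * pol R l := by simp [pol, ev]
    rw [h, coeff_add]
    cases n with
    | zero => simp
    | succ n => rw [coeff_X_mul, ih, coeff_C_succ]; simp

theorem pol_natDegree_le (l : List ℤ) (n : ℕ) (h : l.length ≤ n + 1) : (pol R l).natDegree ≤ n := by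
  rw [natDegree_le_iff_coeff_eq_zero]
  intro N hN
  rw [pol_coeff, List.getD_eq_default _ _ (by omega)]
  simp

/-- derivative -/
def derA : ℤ → List ℤ → List ℤ
  | _, [] => []
  | n, a :: l => n * a :: derA (n + 1) l

theorem ev_derA (n : ℤ) (l : List ℤ) :
    ev (R := R[X]) X (derA n l) = (n : R[X]) * pol R l + X * derivative (pol R l) := by
  induction l generalizing n with
  | nil => simp [pol, ev, derA]
  | cons a l ih =>
    have h : pol R (a :: l) = C (a : R) + X * pol R l := by simp [pol, ev]
    rw [h]
    simp only [derA, ev, ih, derivative_add, derivative_C, derivative_mul, derivative_X]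
    push_cast
    simp only [map_intCast]
    ring

def der : List ℤ → List ℤ
  | [] => []
  | _ :: l => derA 1 l

theorem pol_der (l : List ℤ) : derivative (pol R l) = pol R (der l) := by
  cases l with
  | nil => simp [pol, ev, der]
  | cons a l =>
    have h : pol R (a :: l) = C (a : R) + X * pol R l := by simp [pol, ev]
    rw [h]
    have := ev_derA (R := R) 1 l
    simp only [der]
    rw [show pol R (derA 1 l) = ev X (derA 1 l) from rfl, this]
    simp

end lists
end M11

namespace M11

def fl : List ℤ := [1, 21, 69, -14, -243, -81, 437, 48, -399, 83, 159, -96, 16]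
def uL : List ℤ := [-2053695, -4274988, 12450093, 31719402, -33118023, -49683642, 45633813, 22648164, -30555852, 7941504, -233856]
def vL : List ℤ := [134461, 1373665, 1671962, -3299507, -6463338, 5139967, 6943848, -5271119, -2447939, 2855902, -671536, 19488]
theorem bez_ok : isZ (addL 0 [-769986] (addL 0 (mulL 0 uL fl) (mulL 0 vL (der fl)))) = true := by
  decide +kernel

def gl : List ℤ := [-2229025112064, 7748843470848, -5929015869440, -1507906400256, 86811142464, 74654376321, -8140992246, 411227343, -9306996, 111951, -630]
def gdL : List ℤ := [8926667678416896, -13660452563189760, -5211324519284736, 400025744474112, 430009207608960, -56270538404352, 3316137293952, -85773275136, 1160707968, -7257600, 12672]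
def phL : List (List ℤ) := [[-8301611886575616, 13313956836999168, 3439503804930048, 36108875319552, -231884699515236, 15763677672600, -383936601564, 70916688, 96606756, -1014120, 1692],
  [-22373715727613952, 34521813541453824, 12252296682196992, -593382681476352, -871848691032744, 86692225435776, -4342586959080, 93048917184, -1070630136, 6215616, -13176],
  [5121061360238592, -11022916743069696, 3025969699921920, 202561140883968, -281182334336460, 44154398306232, -2429055286308, 63731812176, -865833300, 4105080, 3780],
  [31233017313755136, -43726225261068288, -25302367889086464, 539835879128832, 1816315814201688, -196803124206480, 10358811622440, -227665884384, 2692479528, -13282704, 5976],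
  [5067069418635264, -9192920788500480, -521807226716160, 621789110995968, 179690408165772, -42502160162376, 3019817960820, -99422960112, 1549237428, -11462472, 28620],
  [-26780003035250688, 40981357689569280, 15633973557854208, -1200077233422336, -1290027622826880, 168811615213056, -9948411881856, 257319825408, -3482123904, 21772800, -38016],
  [8926667678416896, -13660452563189760, -5211324519284736, 400025744474112, 430009207608960, -56270538404352, 3316137293952, -85773275136, 1160707968, -7257600, 12672]]
def qhL : List (List ℤ) := [[-11059347078512640, 17789952566976512, 4643230228231680, -288935456385600, -228722766505617, 26019527135382, -1389884616063, 32661919284, -407154879, 2363670, -3793],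
  [-26206713599754240, 41667244664930304, 11929815658616832, -608503481528256, -645130944285570, 70341448418748, -3500353546542, 78952399560, -948240702, 5309820, -8274],
  [16836036502487040, -27068059289886720, -7163486140345344, 482791729092768, 426755898194112, -52346048353200, 2966340162960, -72110956608, 932357088, -5516208, 8400],
  [30779047607795712, -49082537747611648, -13627489631293440, 496236425478912, 790311925473315, -83082820300866, 4181706553005, -95781411804, 1161158157, -6649794, 11267],
  [-21892875796611072, 34892529863270400, 9818650880916480, -461813570815392, -647462668314636, 74834387439048, -4083175730196, 99080132688, -1271017332, 7600392, -12780],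
  [2231666919604224, -3415113140797440, -1302831129821184, 100006436118528, 107502301902240, -14067634601088, 829034323488, -21443318784, 290176992, -1814400, 3168]]
def fl2 : List (List ℤ) := [[1],
  [21],
  [69],
  [-14],
  [-243],
  [-81],
  [437],
  [48],
  [-399],
  [83],
  [159],
  [-96],
  [16]]

theorem cert_ok : isZ2 (add2 (mul2 11 gl [[16]] (add2 (mul2 11 gl phL phL)
    (mul2 11 gl [[0, -1]] (mul2 11 gl qhL qhL))))
    (mul2 11 gl [[-1]] (mul2 11 gl [gdL] (mul2 11 gl [gdL] fl2)))) = true := by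
  decide +kernel

/-- Frobenius modulo 13 -/
def s1L : List ℤ := [7, 10, 5, 12, 2, 9, 9, 2, 1, 11, 0]
def compL (l : List ℤ) : List ℤ := match l with
  | [] => []
  | a :: l => addL 13 [a] (mulM 13 11 gl s1L (compL l))
def invL : List ℤ := [12, 4, 10, 9, 9, 4, 7, 5, 7, 12, 10]
def powX : ℕ → List ℤ
  | 0 => [1]
  | n + 1 => redX 13 11 gl (powX n)
def sL : ℕ → List ℤ
  | 0 => [0, 1]
  | n + 1 => compL (sL n)
theorem frob_ok1 : powX 13 = s1L := by decide +kernel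
theorem frob_ok2 : isZ (addL 13 [0, -1] (sL 11)) = true := by decide +kernel
theorem frob_ok3 : isZ (addL 13 [-1] (mulM 13 11 gl invL (addL 13 [0, -1] s1L))) = true := by
  decide +kernel
end M11

namespace M11

theorem f0_pol : C (16 : ℚ) * f0 = pol ℚ fl := by
  apply Polynomial.funext
  intro x
  have h := pol_eval (R := ℚ) x fl
  rw [Polynomial.coe_aeval_eq_eval] at h
  rw [h]
  simp only [f0, fl, ev, eval_mul, eval_sub, eval_C, eval_pow, eval_X, eval_one, eval_ofNat]
  push_cast
  ring

theorem f0_root {A : Type*} [Field A] [Algebra ℚ A] (x : A) : aeval x f0 = 0 ↔ ev x fl = 0 := by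
  have h := pol_eval (R := ℚ) x fl
  rw [← f0_pol, map_mul, aeval_C] at h
  rw [← h, mul_eq_zero, or_iff_right]
  rw [map_ofNat]
  have := algebraRat.charZero A
  norm_num

theorem f0_coeff (n : ℕ) : f0.coeff n = ((fl.getD n 0 : ℤ) : ℚ) / 16 := by
  have := congrArg (fun p => p.coeff n) f0_pol
  simp only [coeff_C_mul, pol_coeff] at this
  rw [← this]; ring

theorem f0_natDegree : f0.natDegree = 12 := by
  apply le_antisymm
  · rw [natDegree_le_iff_coeff_eq_zero]
    intro N hN
    rw [f0_coeff, List.getD_eq_default _ _ (by simp [fl]; omega)]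
    simp
  · apply le_natDegree_of_ne_zero
    rw [f0_coeff]; simp [fl]

theorem f0_monic : f0.Monic := by
  rw [Monic, leadingCoeff, f0_natDegree, f0_coeff]
  simp [fl]

theorem f0_ne : f0 ≠ 0 := f0_monic.ne_zero

theorem pol_isUnit_of {F : Type*} [Field F] [CharZero F] : IsCoprime (pol F fl) (derivative (pol F fl)) := by
  have h := ev_isZ (R := F[X]) X _ bez_ok
  rw [ev_addL Int.cast_zero, ev_addL Int.cast_zero, ev_mulL Int.cast_zero, ev_mulL Int.cast_zero] at h
  rw [pol_der]
  change _ + (_ * pol F fl + _ * pol F (der fl)) = 0 at h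
  simp only [ev] at h
  rw [mul_zero, add_zero] at h
  generalize hc : (-769986 : ℤ) = c at h
  have hc0 : c ≠ 0 := by rw [← hc]; norm_num
  have hcF : (c : F) ≠ 0 := by exact_mod_cast hc0
  refine ⟨- C (c : F)⁻¹ * ev X uL, - C (c : F)⁻¹ * ev X vL, ?_⟩
  have h2 : C (c : F)⁻¹ * (c : F[X]) = 1 := by
    rw [← map_intCast (C : F →+* F[X]), ← C_mul, inv_mul_cancel₀ hcF, C_1]
  linear_combination h2 - C (c : F)⁻¹ * h

theorem f0_sep : f0.Separable := by
  have h := pol_isUnit_of (F := ℚ)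
  rw [← f0_pol] at h
  exact Separable.of_mul_right (f := C (16 : ℚ)) h

end M11

namespace M11

theorem p5_ok : (phL.getD 5 [] == smulL 0 (-3) gdL) = true := by decide +kernel
theorem q5_ok : (smulL 0 4 (qhL.getD 5 []) == gdL) = true := by decide +kernel

section hex
variable {E : Type*} [Field E]

noncomputable def Hp (Y : E) : E[X] := ev2 X (C (Y * Y)) phL + C Y * ev2 X (C (Y * Y)) qhL

theorem ev2_coeff (z : E) (l : List (List ℤ)) (n : ℕ) :
    (ev2 (R := E[X]) X (C z) l).coeff n = ev z (l.getD n []) := by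
  induction l generalizing n with
  | nil => simp [ev2, ev]
  | cons a l ih =>
    rw [ev2, ← ev_map, coeff_add]
    cases n with
    | zero => simp
    | succ n => rw [coeff_X_mul, ih, coeff_C_succ]; simp

theorem Hp_coeff (Y : E) (n : ℕ) :
    (Hp Y).coeff n = ev (Y * Y) (phL.getD n []) + Y * ev (Y * Y) (qhL.getD n []) := by
  rw [Hp, coeff_add, coeff_C_mul, ev2_coeff, ev2_coeff]

theorem Hp_deg (Y : E) (hc : ev (Y * Y) gdL ≠ 0) : (Hp Y).natDegree = 6 := by
  apply le_antisymm
  · rw [natDegree_le_iff_coeff_eq_zero]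
    intro N hN
    rw [Hp_coeff, List.getD_eq_default _ _ (by simp [phL]; omega),
      List.getD_eq_default _ _ (by simp [qhL]; omega)]
    simp [ev]
  · apply le_natDegree_of_ne_zero
    rw [Hp_coeff]
    have h1 : phL.getD 6 [] = gdL := by decide +kernel
    have h2 : qhL.getD 6 [] = [] := by decide +kernel
    rw [h1, h2]
    simpa [ev] using hc

theorem Hp_c6 (Y : E) : (Hp Y).coeff 6 = ev (Y * Y) gdL := by
  rw [Hp_coeff]
  have h1 : phL.getD 6 [] = gdL := by decide +kernel
  have h2 : qhL.getD 6 [] = [] := by decide +kernel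
  rw [h1, h2]
  simp [ev]

theorem Hp_c5 (Y : E) : 4 * (Hp Y).coeff 5 = (Y - 12) * ev (Y * Y) gdL := by
  rw [Hp_coeff]
  have h1 : phL.getD 5 [] = smulL 0 (-3) gdL := by simpa using p5_ok
  have h2 : smulL 0 4 (qhL.getD 5 []) = gdL := by simpa using q5_ok
  rw [h1, ev_smulL Int.cast_zero]
  have h3 := ev_smulL (R := E) (p := 0) Int.cast_zero (Y * Y) 4 (qhL.getD 5 [])
  rw [h2] at h3
  push_cast at h3 ⊢
  linear_combination -Y * h3

theorem Hp_mul (Y : E) (hg : (Y * Y) ^ 11 + ev (Y * Y) gl = 0) (x : E) :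
    ev (Y * Y) gdL ^ 2 * ev x fl = 16 * ((Hp Y).eval x * (Hp (-Y)).eval x) := by
  have h := ev2_isZ2 x (Y * Y) _ cert_ok
  simp only [ev2_add2, ev2_mul2 x (Y * Y) 11 gl hg] at h
  have hf : ev2 x (Y * Y) fl2 = ev x fl := by
    simp only [fl2, fl, ev2, ev]
    simp
  rw [hf] at h
  have he : ∀ y : E, (Hp y).eval x = ev2 x (y * y) phL + y * ev2 x (y * y) qhL := by
    intro y
    have := fun l => ev2_map (evalRingHom x) X (C (y * y)) l
    simp only [coe_evalRingHom, eval_X, eval_C] at this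
    rw [Hp, eval_add, eval_mul, eval_C, this, this]
  rw [he, he, neg_mul_neg]
  simp only [ev2, ev] at h
  push_cast at h
  linear_combination -h

theorem hex (S : Finset E) (hS : ∀ x, ev x fl = 0 ↔ x ∈ S) (hcard : S.card = 12) [CharZero E]
    (Y : E) (hg : (Y * Y) ^ 11 + ev (Y * Y) gl = 0) (hc : ev (Y * Y) gdL ≠ 0) :
    ∃ B ⊆ S, B.card = 6 ∧ (∀ x ∈ S, x ∈ B ↔ (Hp Y).eval x = 0) ∧
      (∀ x ∈ S, x ∈ B ↔ ¬ (Hp (-Y)).eval x = 0) ∧ Y = 12 - 4 * ∑ x ∈ B, x := by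
  classical
  have hc' : ev (-Y * -Y) gdL ≠ 0 := by rwa [neg_mul_neg]
  have hle : ∀ y : E, ev (y * y) gdL ≠ 0 → (S.filter fun x => (Hp y).eval x = 0).card ≤ 6 := by
    intro y hy
    rw [← Hp_deg y hy]
    have hne : Hp y ≠ 0 := by
      intro h0
      have := Hp_deg y hy
      rw [h0] at this; simp at this
    apply (Finset.card_le_card _).trans (le_trans (Multiset.toFinset_card_le _) (card_roots' (Hp y)))
    intro x hx
    rw [Finset.mem_filter] at hx
    rw [Multiset.mem_toFinset, mem_roots hne]
    exact hx.2
  have hcov : S = (S.filter fun x => (Hp Y).eval x = 0) ∪ (S.filter fun x => (Hp (-Y)).eval x = 0) := by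
    ext x
    simp only [Finset.mem_union, Finset.mem_filter]
    constructor
    · intro hx
      have h := Hp_mul Y hg x
      rw [(hS x).2 hx, mul_zero] at h
      have h16 : (16 : E) ≠ 0 := by norm_num
      rcases mul_eq_zero.1 ((mul_eq_zero.1 h.symm).resolve_left h16) with h | h
      · exact Or.inl ⟨hx, h⟩
      · exact Or.inr ⟨hx, h⟩
    · rintro (h | h) <;> exact h.1
  have h1 := hle Y hc
  have h2 := hle (-Y) hc'
  have h3 := Finset.card_union_add_card_inter (S.filter fun x => (Hp Y).eval x = 0)
    (S.filter fun x => (Hp (-Y)).eval x = 0)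
  rw [← hcov, hcard] at h3
  have h4 : (S.filter fun x => (Hp Y).eval x = 0).card = 6 := by omega
  have h5 : ((S.filter fun x => (Hp Y).eval x = 0) ∩ (S.filter fun x => (Hp (-Y)).eval x = 0)) = ∅ := by
    rw [← Finset.card_eq_zero]; omega
  refine ⟨S.filter fun x => (Hp Y).eval x = 0, Finset.filter_subset _ _, h4, ?_, ?_, ?_⟩
  · intro x hx; simp [hx]
  · intro x hx
    constructor
    · intro h h'
      have : x ∈ (S.filter fun x => (Hp Y).eval x = 0) ∩ (S.filter fun x => (Hp (-Y)).eval x = 0) :=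
        Finset.mem_inter.2 ⟨h, Finset.mem_filter.2 ⟨hx, h'⟩⟩
      rw [h5] at this
      simp at this
    · intro h
      have hx' := hx
      rw [hcov, Finset.mem_union] at hx'
      rcases hx' with h' | h'
      · exact h'
      · exact absurd (Finset.mem_filter.1 h').2 h
  · set B := S.filter fun x => (Hp Y).eval x = 0 with hB
    have hmon : (∏ a ∈ B, (X - C a)).Monic := monic_prod_of_monic _ _ fun i _ => monic_X_sub_C i
    have hdegP : (∏ a ∈ B, (X - C a)).natDegree = 6 := by
      rw [natDegree_prod_of_monic _ _ fun i _ => monic_X_sub_C i]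
      simp [h4]
    have key : Hp Y = C (ev (Y * Y) gdL) * ∏ a ∈ B, (X - C a) := by
      apply Polynomial.eq_of_degree_sub_lt_of_eval_finset_eq B
      · rw [h4]
        rw [degree_lt_iff_coeff_zero]
        intro m hm
        rcases eq_or_lt_of_le hm with h | h
        · rw [coeff_sub, ← h, coeff_C_mul, Hp_c6]
          have : (∏ a ∈ B, (X - C a)).coeff 6 = 1 := by rw [← hdegP]; exact hmon.coeff_natDegree
          rw [this]; ring
        · rw [coeff_sub, coeff_C_mul, coeff_eq_zero_of_natDegree_lt (by rw [Hp_deg Y hc]; exact_mod_cast h),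
            coeff_eq_zero_of_natDegree_lt (by rw [hdegP]; exact_mod_cast h)]
          ring
      · intro x hx
        rw [(Finset.mem_filter.1 hx).2, eval_mul, eval_prod, Finset.prod_eq_zero hx (by simp), mul_zero]
    have h6 := Polynomial.prod_X_sub_C_coeff_card_pred B (fun a => a) (by omega)
    rw [h4] at h6
    have h7 := Hp_c5 Y
    rw [key, coeff_C_mul, h6] at h7
    apply mul_right_cancel₀ hc
    linear_combination -h7

end hex
end M11

namespace M11

def gL : List ℤ := gl ++ [1]

theorem gL_ev {R : Type*} [CommRing R] (x : R) : ev x gL = x ^ 11 + ev x gl := by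
  rw [gL, ev_append]
  have : gl.length = 11 := rfl
  rw [this]; simp [ev]; ring

theorem gL_monic (R : Type*) [CommRing R] [Nontrivial R] : (pol R gL).Monic ∧ (pol R gL).natDegree = 11 := by
  have h1 : (pol R gL).natDegree ≤ 11 := pol_natDegree_le _ _ (by decide)
  have h2 : (pol R gL).coeff 11 = 1 := by
    rw [pol_coeff]; simp [gL, gl]
  exact ⟨monic_of_natDegree_le_of_coeff_eq_one _ h1 h2,
    natDegree_eq_of_le_of_coeff_ne_zero h1 (by rw [h2]; exact one_ne_zero)⟩

theorem frob {F : Type*} [Field F] [CharP F 13] (t : F) (ht : t ^ 11 + ev t gl = 0) :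
    t ^ 13 ≠ t ∧ ∀ d < 11, 0 < d → t ^ 13 ^ d ≠ t := by
  have hp : ((13 : ℤ) : F) = 0 := by exact_mod_cast CharP.cast_eq_zero F 13
  have h1 : ∀ n, ev t (powX n) = t ^ n := by
    intro n
    induction n with
    | zero => simp [powX, ev]
    | succ n ih => rw [powX, ev_redX hp t 11 gl ht, ih, pow_succ']
  have hs1 : ev t s1L = t ^ 13 := by rw [← frob_ok1, h1]
  have hcomp : ∀ l, ev t (compL l) = ev (t ^ 13) l := by
    intro l
    induction l with
    | nil => simp [compL, ev]
    | cons a l ih =>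
      rw [compL, ev_addL hp, ev_mulM hp t 11 gl ht, ih, hs1]
      simp [ev]
  have hfr : ∀ (x : F) l, ev (x ^ 13) l = ev x l ^ 13 := by
    intro x l
    have : Fact (Nat.Prime 13) := ⟨by norm_num⟩
    have := ev_map (frobenius F 13) x l
    rw [frobenius_def, frobenius_def] at this
    exact this.symm
  have hs : ∀ n, ev t (sL n) = t ^ 13 ^ n := by
    intro n
    induction n with
    | zero => simp [sL, ev]
    | succ n ih => rw [sL, hcomp, hfr, ih, ← pow_mul, ← pow_succ]
  have h11 : t ^ 13 ^ 11 = t := by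
    have := ev_isZ t _ frob_ok2
    rw [ev_addL hp, hs] at this
    simp only [ev] at this
    push_cast at this
    linear_combination this
  have hne : t ^ 13 ≠ t := by
    intro h
    have := ev_isZ t _ frob_ok3
    rw [ev_addL hp, ev_mulM hp t 11 gl ht, ev_addL hp, hs1, h] at this
    simp [ev] at this
  refine ⟨hne, ?_⟩
  intro d hd hd0 h
  apply hne
  have hit : ∀ n, (fun x : F => x ^ 13)^[n] t = t ^ 13 ^ n := by
    intro n
    induction n with
    | zero => simp
    | succ n ih => rw [Function.iterate_succ_apply', ih, ← pow_mul, ← pow_succ]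
  have e1 : Function.IsPeriodicPt (fun x : F => x ^ 13) d t := by
    rw [Function.IsPeriodicPt, Function.IsFixedPt, hit, h]
  have e2 : Function.IsPeriodicPt (fun x : F => x ^ 13) 11 t := by
    rw [Function.IsPeriodicPt, Function.IsFixedPt, hit, h11]
  have e3 := e1.gcd e2
  have : Nat.gcd d 11 = 1 := by interval_cases d <;> rfl
  rw [this] at e3
  exact e3

theorem gL_irr13 : Irreducible (pol (ZMod 13) gL) := by
  have : Fact (Nat.Prime 13) := ⟨by norm_num⟩
  obtain ⟨hm, hd⟩ := gL_monic (ZMod 13)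
  have hne1 : pol (ZMod 13) gL ≠ 1 := by
    intro h; rw [h] at hd; simp at hd
  rw [hm.irreducible_iff_lt_natDegree_lt hne1]
  intro q hq hqd hdvd
  rw [hd, Finset.mem_Ioc] at hqd
  obtain ⟨h, hirr, hhq⟩ := exists_irreducible_of_natDegree_pos hqd.1
  have : Fact (Irreducible h) := ⟨hirr⟩
  have hle := natDegree_le_of_dvd hhq hq.ne_zero
  have hpos := hirr.natDegree_pos
  let F := AdjoinRoot h
  have : Module.Finite (ZMod 13) F := (AdjoinRoot.powerBasis hirr.ne_zero).finite
  have : Finite F := Module.finite_of_finite (ZMod 13)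
  have := Fintype.ofFinite F
  have hcard : Fintype.card F = 13 ^ h.natDegree := by
    rw [Module.card_eq_pow_finrank (K := ZMod 13), ZMod.card,
      (AdjoinRoot.powerBasis hirr.ne_zero).finrank, AdjoinRoot.powerBasis_dim]
  have : CharP F 13 := charP_of_injective_algebraMap (algebraMap (ZMod 13) F).injective 13
  have hroot : aeval (AdjoinRoot.root h) (pol (ZMod 13) gL) = 0 := by
    rw [AdjoinRoot.aeval_eq, AdjoinRoot.mk_eq_zero]
    exact hhq.trans hdvd
  rw [pol_eval, gL_ev] at hroot
  refine (frob (AdjoinRoot.root h : F) hroot).2 h.natDegree (by omega) hpos ?_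
  rw [← hcard]
  exact FiniteField.pow_card _

theorem gL_irr : Irreducible (pol ℚ gL) := by
  have : Fact (Nat.Prime 13) := ⟨by norm_num⟩
  have h1 : Irreducible (pol ℤ gL) := by
    apply (gL_monic ℤ).1.irreducible_of_irreducible_map (Int.castRingHom (ZMod 13))
    rw [pol_map]; exact gL_irr13
  have := (gL_monic ℤ).1.irreducible_iff_irreducible_map_fraction_map (K := ℚ) |>.1 h1
  rwa [pol_map] at this

theorem gL_sep : (pol ℚ gL).Separable := gL_irr.separable

theorem gdL_ok : (gdL == smulL 0 1152 (der gL)) = true := by decide +kernel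

theorem gd_ne {A : Type*} [Field A] [Algebra ℚ A] (z : A) (hz : z ^ 11 + ev z gl = 0) : ev z gdL ≠ 0 := by
  have := algebraRat.charZero A
  have h1 : gdL = smulL 0 1152 (der gL) := by simpa using gdL_ok
  rw [h1, ev_smulL Int.cast_zero]
  apply mul_ne_zero
  · norm_num
  · rw [← pol_eval (R := ℚ), ← pol_der]
    apply gL_sep.aeval_derivative_ne_zero
    rw [pol_eval, gL_ev, hz]

end M11

namespace M11

def FL : List ℤ := [1048576, 5505024, 4521984, -229376, -995328, -82944, 111872, 3072, -6384, 332, 159, -24, 1]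

theorem no_root17 : ∀ a : ZMod 17, ev a FL ≠ 0 := by decide +kernel

theorem FL_ev {A : Type*} [CommRing A] (r : A) : ev (4 * r) FL = 4 ^ 10 * ev r fl := by
  simp only [FL, fl, ev]
  push_cast
  ring

theorem no_rat_root (r : ℚ) : ev r fl ≠ 0 := by
  intro h
  have h1 : ev (4 * r) FL = 0 := by rw [FL_ev, h, mul_zero]
  have hm : (pol ℤ FL).Monic :=
    monic_of_natDegree_le_of_coeff_eq_one 12 (pol_natDegree_le _ _ (by decide))
      (by rw [pol_coeff]; simp [FL])
  have hi : IsIntegral ℤ (4 * r) := ⟨pol ℤ FL, hm, by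
    rw [← aeval_def, pol_eval]; exact h1⟩
  obtain ⟨n, hn⟩ := IsIntegrallyClosed.isIntegral_iff.1 hi
  rw [← hn] at h1
  rw [← ev_map (algebraMap ℤ ℚ)] at h1
  have h2 : ev n FL = 0 := by
    apply (algebraMap ℤ ℚ).injective_int
    rw [h1, map_zero]
  have h3 := ev_map (Int.castRingHom (ZMod 17)) n FL
  rw [h2, map_zero] at h3
  exact no_root17 _ h3.symm

section gal
variable {L : Type*} [Field L] [Algebra ℚ L]

abbrev Om (L : Type*) [Field L] := {x : L // ev x fl = 0}
abbrev Tm (L : Type*) [Field L] := {z : L // z ^ 11 + ev z gl = 0}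

instance actOm : MulAction (L ≃ₐ[ℚ] L) (Om L) where
  smul σ x := ⟨σ x.1, by rw [← RingHom.coe_coe, ← ev_map, x.2, map_zero]⟩
  one_smul x := rfl
  mul_smul σ τ x := rfl

instance actTm : MulAction (L ≃ₐ[ℚ] L) (Tm L) where
  smul σ x := ⟨σ x.1, by rw [← map_pow, ← RingHom.coe_coe, ← ev_map, ← map_add, x.2, map_zero]⟩
  one_smul x := rfl
  mul_smul σ τ x := rfl

theorem actOm_coe (σ : L ≃ₐ[ℚ] L) (x : Om L) : (σ • x).1 = σ x.1 := rfl
theorem actTm_coe (σ : L ≃ₐ[ℚ] L) (x : Tm L) : (σ • x).1 = σ x.1 := rfl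

theorem rootsOf (hs : (f0.map (algebraMap ℚ L)).Splits) :
    ∃ S : Finset L, (∀ x, ev x fl = 0 ↔ x ∈ S) ∧ S.card = 12 := by
  classical
  have h := card_rootSet_eq_natDegree f0_sep hs
  rw [f0_natDegree] at h
  refine ⟨(f0.rootSet L).toFinset, fun x => ?_, ?_⟩
  · rw [Set.mem_toFinset, mem_rootSet, f0_root]
    simp [f0_ne]
  · rw [Set.toFinset_card]; exact h

theorem extRoots (S : Finset L) (hS : ∀ x, ev x fl = 0 ↔ x ∈ S) (hcard : S.card = 12)
    {E : Type*} [Field E] [Algebra L E] (x : E) (hx : ev x fl = 0) : ∃ a ∈ S, algebraMap L E a = x := by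
  classical
  have := algebraRat.charZero L
  have hE : CharZero E := charZero_of_injective_algebraMap (algebraMap L E).injective
  have hd : (pol E fl).natDegree ≤ 12 := pol_natDegree_le _ _ (by decide)
  have hne : pol E fl ≠ 0 := by
    intro h
    have h2 := pol_coeff (R := E) fl 0
    rw [h] at h2
    simp [fl] at h2
  have hmem : ∀ y, y ∈ (pol E fl).roots.toFinset ↔ ev y fl = 0 := by
    intro y
    rw [Multiset.mem_toFinset, mem_roots hne, IsRoot, ← coe_aeval_eq_eval, pol_eval]
  have hsub : S.image (algebraMap L E) ⊆ (pol E fl).roots.toFinset := by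
    intro y hy
    obtain ⟨a, ha, rfl⟩ := Finset.mem_image.1 hy
    rw [hmem, ← ev_map, (hS a).2 ha, map_zero]
  have hc : (S.image (algebraMap L E)).card = 12 := by
    rw [Finset.card_image_of_injective _ (algebraMap L E).injective, hcard]
  have heq := Finset.eq_of_subset_of_card_le hsub (by
    rw [hc]
    exact (Multiset.toFinset_card_le _).trans ((card_roots' _).trans hd))
  have hx' := (hmem x).2 hx
  rw [← heq] at hx'
  exact Finset.mem_image.1 hx'

theorem sqrtExists (S : Finset L) (hS : ∀ x, ev x fl = 0 ↔ x ∈ S) (hcard : S.card = 12)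
    (z : AlgebraicClosure L) (hz : z ^ 11 + ev z gl = 0) :
    ∃ y : L, z = algebraMap L _ (y * y) ∧ (y * y) ^ 11 + ev (y * y) gl = 0 := by
  classical
  have := algebraRat.charZero L
  have hE : CharZero (AlgebraicClosure L) :=
    charZero_of_injective_algebraMap (algebraMap L (AlgebraicClosure L)).injective
  obtain ⟨Y, hY⟩ := IsAlgClosed.exists_eq_mul_self z
  rw [hY] at hz
  have hgd := gd_ne (Y * Y) hz
  obtain ⟨B, hBS, -, -, -, hYs⟩ := hex (S.image (algebraMap L (AlgebraicClosure L))) (by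
    intro x
    constructor
    · intro hx
      obtain ⟨a, ha, e⟩ := extRoots S hS hcard x hx
      exact Finset.mem_image.2 ⟨a, ha, e⟩
    · intro hx
      obtain ⟨a, ha, rfl⟩ := Finset.mem_image.1 hx
      rw [← ev_map, (hS a).2 ha, map_zero])
    (by rw [Finset.card_image_of_injective _ (algebraMap L (AlgebraicClosure L)).injective, hcard]) Y hz hgd
  have hmem : Y ∈ (algebraMap L (AlgebraicClosure L)).range := by
    rw [hYs]
    apply Subring.sub_mem
    · exact ⟨12, map_ofNat _ 12⟩
    · apply Subring.mul_mem
      · exact ⟨4, map_ofNat _ 4⟩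
      · apply Subring.sum_mem
        intro x hx
        obtain ⟨a, _, rfl⟩ := Finset.mem_image.1 (hBS hx)
        exact ⟨a, rfl⟩
  obtain ⟨y, rfl⟩ := hmem
  refine ⟨y, by rw [hY, map_mul], ?_⟩
  apply (algebraMap L (AlgebraicClosure L)).injective
  rw [map_add, map_pow, map_zero, ev_map, map_mul]
  exact hz

theorem cardT (S : Finset L) (hS : ∀ x, ev x fl = 0 ↔ x ∈ S) (hcard : S.card = 12) :
    Nat.card (Tm L) = 11 := by
  classical
  have h := card_rootSet_eq_natDegree (K := AlgebraicClosure L) gL_sep (IsAlgClosed.splits _)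
  rw [(gL_monic ℚ).2, ← Nat.card_eq_fintype_card] at h
  rw [← h]
  apply Nat.card_congr
  refine Equiv.ofBijective (fun z => ⟨algebraMap L _ z.1, ?_⟩) ⟨?_, ?_⟩
  · rw [mem_rootSet]
    refine ⟨gL_irr.ne_zero, ?_⟩
    rw [pol_eval, gL_ev, ← ev_map, ← map_pow, ← map_add, z.2, map_zero]
  · intro a b hab
    apply Subtype.ext
    exact (algebraMap L (AlgebraicClosure L)).injective (Subtype.ext_iff.1 hab)
  · rintro ⟨z, hz⟩
    rw [mem_rootSet, pol_eval, gL_ev] at hz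
    obtain ⟨y, h1, h2⟩ := sqrtExists S hS hcard z hz.2
    exact ⟨⟨y * y, h2⟩, Subtype.ext h1.symm⟩

theorem gal_main [FiniteDimensional ℚ L] [IsGalois ℚ L] (hs : (f0.map (algebraMap ℚ L)).Splits)
    (hgen : ∀ σ τ : L ≃ₐ[ℚ] L, (∀ x, ev x fl = 0 → σ x = τ x) → σ = τ)
    (τ : L ≃ₐ[ℚ] L) (hτ1 : τ ≠ 1) (hτ2 : τ * τ = 1) (p q : L) (hp0 : ev p fl = 0) (hq0 : ev q fl = 0)
    (hpq : p ≠ q) (hp : τ p = p) (hq : τ q = q) :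
    (∀ a b : L, ev a fl = 0 → ev b fl = 0 → ∃ g : L ≃ₐ[ℚ] L, g a = b) ∧
      IsSimpleGroup (L ≃ₐ[ℚ] L) ∧ Nat.card (L ≃ₐ[ℚ] L) = 7920 := by
  classical
  have := algebraRat.charZero L
  obtain ⟨S, hS, hcard⟩ := rootsOf hs
  have hΩ : Nat.card (Om L) = 12 := by
    rw [Nat.card_congr (Equiv.subtypeEquivRight hS), Nat.card_eq_fintype_card, Fintype.card_coe, hcard]
  have hT := cardT S hS hcard
  have hfΩ : Finite (Om L) := Nat.finite_of_card_ne_zero (by omega)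
  have hfT : Finite (Tm L) := Nat.finite_of_card_ne_zero (by omega)
  have hy : ∀ z : Tm L, ∃ y : L, y * y = z.1 := by
    intro z
    obtain ⟨y, h1, h2⟩ := sqrtExists S hS hcard (algebraMap L _ z.1)
      (by rw [← ev_map, ← map_pow, ← map_add, z.2, map_zero])
    exact ⟨y, ((algebraMap L (AlgebraicClosure L)).injective h1).symm⟩
  choose y hy using hy
  have hyg : ∀ z, (y z * y z) ^ 11 + ev (y z * y z) gl = 0 := by
    intro z; rw [hy z]; exact z.2
  have hh := fun z => hex S hS hcard (y z) (hyg z) (gd_ne _ (hyg z))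
  let β : Tm L → Set (Om L) := fun z => {a | (Hp (y z)).eval a.1 = 0}
  have h6 : ∀ t, (β t).ncard = 6 := by
    intro t
    obtain ⟨B, hBS, hB6, hB, -, -⟩ := hh t
    rw [← hB6, ← Set.ncard_coe_finset B, ← Set.ncard_image_of_injective (β t) Subtype.val_injective]
    congr 1
    ext x
    simp only [Set.mem_image, Finset.mem_coe]
    constructor
    · rintro ⟨a, ha, rfl⟩
      exact (hB _ ((hS _).1 a.2)).2 ha
    · intro hx
      exact ⟨⟨x, (hS x).2 (hBS hx)⟩, (hB x (hBS hx)).1 hx, rfl⟩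
  have hneg : ∀ (t : Tm L) (a : Om L), (Hp (-(y t))).eval a.1 = 0 ↔ ¬ (Hp (y t)).eval a.1 = 0 := by
    intro t a
    obtain ⟨B, hBS, hB6, hB, hB', -⟩ := hh t
    rw [← hB _ ((hS _).1 a.2), hB' _ ((hS _).1 a.2), not_not]
  have hHp : ∀ (σ : L ≃ₐ[ℚ] L) (Y x : L), (Hp (σ Y)).eval (σ x) = 0 ↔ (Hp Y).eval x = 0 := by
    intro σ Y x
    have he : ∀ y x : L, (Hp y).eval x = ev2 x (y * y) phL + y * ev2 x (y * y) qhL := by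
      intro y x
      have := fun l => ev2_map (evalRingHom x) X (C (y * y)) l
      simp only [coe_evalRingHom, eval_X, eval_C] at this
      rw [Hp, eval_add, eval_mul, eval_C, this, this]
    have : (Hp (σ Y)).eval (σ x) = σ ((Hp Y).eval x) := by
      rw [he, he, map_add, map_mul]
      have := fun l => ev2_map (σ : L →+* L) x (Y * Y) l
      simp only [RingHom.coe_coe, map_mul] at this
      rw [this, this]
    rw [this]
    exact map_eq_zero_iff σ σ.injective
  have hinv : ∀ (g : L ≃ₐ[ℚ] L) a b t, RR β (g • a) (g • b) (g • t) ↔ RR β a b t := by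
    intro g a b t
    have hyy : g (y t) = y (g • t) ∨ g (y t) = - y (g • t) := by
      rw [← mul_self_eq_mul_self_iff, ← map_mul, hy, hy, actTm_coe]
    have hA : ∀ a : Om L, a ∈ β t ↔ (Hp (g (y t))).eval (g • a).1 = 0 := by
      intro a
      rw [actOm_coe, hHp]; rfl
    have hB : ∀ a : Om L, g • a ∈ β (g • t) ↔ (Hp (y (g • t))).eval (g • a).1 = 0 := by
      intro a; rfl
    unfold RR
    rw [hA, hA, hB, hB]
    rcases hyy with e | e
    · rw [e]
    · rw [e, hneg, hneg]
      tauto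
  have htr : ∀ s t : Tm L, ∃ g : L ≃ₐ[ℚ] L, g • s = t := by
    intro s t
    have hz : ∀ s : Tm L, aeval s.1 (pol ℚ gL) = 0 := by
      intro s; rw [pol_eval, gL_ev, s.2]
    have hm : minpoly ℚ s.1 = pol ℚ gL :=
      (minpoly.eq_of_irreducible_of_monic gL_irr (hz s) (gL_monic ℚ).1).symm
    obtain ⟨σ, hσ⟩ := minpoly.exists_algEquiv_of_root' (Algebra.IsAlgebraic.isAlgebraic (R := ℚ) s.1) (x := t.1)
      (by rw [hm]; exact hz t)
    exact ⟨σ, Subtype.ext hσ⟩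
  have hfix : ∀ a : Om L, ∃ n : L ≃ₐ[ℚ] L, n • a ≠ a := by
    intro a
    by_contra h
    push Not at h
    have h2 : a.1 ∈ (⊥ : IntermediateField ℚ L) := by
      rw [IsGalois.mem_bot_iff_fixed]
      intro f
      exact Subtype.ext_iff.1 (h f)
    obtain ⟨r, hr⟩ := IntermediateField.mem_bot.1 h2
    apply no_rat_root r
    apply (algebraMap ℚ L).injective
    rw [map_zero, ev_map, hr, a.2]
  have hfaith : FaithfulSMul (L ≃ₐ[ℚ] L) (Om L) := ⟨by
    intro σ τ h
    apply hgen
    intro x hx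
    exact Subtype.ext_iff.1 (h ⟨x, hx⟩)⟩
  obtain ⟨h1, h2, h3⟩ := core_main β hinv hΩ hT h6 htr hfix τ hτ1 hτ2 ⟨p, hp0⟩ ⟨q, hq0⟩
    (fun h => hpq (Subtype.ext_iff.1 h)) (Subtype.ext hp) (Subtype.ext hq)
  refine ⟨?_, h2, h3⟩
  intro a b ha hb
  obtain ⟨g, hg⟩ := h1 ⟨a, ha⟩ ⟨b, hb⟩
  exact ⟨g, Subtype.ext_iff.1 hg⟩

end gal
end M11

namespace M11

theorem ev_ofReal (r : ℝ) (l : List ℤ) : ev (r : ℂ) l = ((ev r l : ℝ) : ℂ) :=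
  (ev_map Complex.ofRealHom r l).symm

theorem ev_cont (l : List ℤ) : Continuous fun r : ℝ => ev r l := by
  induction l with
  | nil => simp only [ev]; fun_prop
  | cons a l ih => simp only [ev]; fun_prop

theorem real_root (a b : ℝ) (hab : a ≤ b) (h0 : ev a fl ≤ 0) (h1 : 0 ≤ ev b fl) :
    ∃ r, a ≤ r ∧ r ≤ b ∧ ev r fl = 0 := by
  obtain ⟨r, hr, h⟩ := intermediate_value_Icc hab (ev_cont fl).continuousOn ⟨h0, h1⟩
  exact ⟨r, hr.1, hr.2, h⟩

theorem exists_nonreal : ∃ a : ℂ, ev a fl = 0 ∧ (starRingEnd ℂ) a ≠ a := by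
  by_contra hcon
  push Not at hcon
  have hs : (f0.map (algebraMap ℚ ℂ)).Splits := IsAlgClosed.splits _
  have hre : ∀ a ∈ f0.aroots ℂ, a.im = 0 := by
    intro a ha
    rw [mem_aroots, f0_root] at ha
    exact Complex.conj_eq_iff_im.1 (hcon a ha.2)
  have hnorm : ∀ z : ℂ, ‖ev z fl‖ = 16 * ((f0.aroots ℂ).map fun a => ‖z - a‖).prod := by
    intro z
    rw [← pol_eval (R := ℚ), ← f0_pol, map_mul, hs.aeval_eq_prod_aroots_of_monic f0_monic, norm_mul,
      aeval_C]
    congr 1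
    · simp
    · exact (Multiset.prod_hom' _ (normHom : ℂ →*₀ ℝ) _).symm
  have hle : ‖ev ((11 / 8 : ℝ) : ℂ) fl‖ ≤ ‖ev ((11 / 8 : ℝ) + (1 / 8 : ℝ) * Complex.I : ℂ) fl‖ := by
    rw [hnorm, hnorm]
    apply mul_le_mul_of_nonneg_left _ (by norm_num)
    apply Multiset.prod_map_le_prod_map₀
    · intro a _; exact norm_nonneg _
    · intro a ha
      have := hre a ha
      have h1 := Complex.abs_re_le_norm ((11 / 8 : ℝ) + (1 / 8 : ℝ) * Complex.I - a : ℂ)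
      have h2 : (((11 / 8 : ℝ) : ℂ) - a) = (((11 / 8 : ℝ) + (1 / 8 : ℝ) * Complex.I - a : ℂ).re : ℂ) := by
        apply Complex.ext <;> simp [this]
      rw [h2, Complex.norm_real]
      exact h1
  have h2 : ev ((11 / 8 : ℝ) : ℂ) fl = ((ev (11 / 8 : ℝ) fl : ℝ) : ℂ) := ev_ofReal _ _
  have hI := Complex.I_mul_I
  have h3 : ∃ u v : ℝ, ev ((11 / 8 : ℝ) + (1 / 8 : ℝ) * Complex.I : ℂ) fl = u + v * Complex.I ∧
      u * u + v * v < (1 / 10 : ℝ) := by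
    refine ⟨11454687/67108864, 4668273/33554432, ?_, by norm_num⟩
    apply Complex.ext <;> simp [fl, ev] <;> norm_num
  obtain ⟨u, v, e, huv⟩ := h3
  rw [e, h2, Complex.norm_real] at hle
  have h4 : (1 / 10 : ℝ) < (ev (11 / 8 : ℝ) fl) * (ev (11 / 8 : ℝ) fl) := by
    simp only [fl, ev]
    norm_num
  have h5 := mul_self_le_mul_self (norm_nonneg _) hle
  rw [Real.norm_eq_abs, abs_mul_abs_self, Complex.norm_mul_self_eq_normSq, Complex.normSq_add_mul_I] at h5
  nlinarith

theorem gal_main2 {L : Type*} [Field L] [Algebra ℚ L] [FiniteDimensional ℚ L] [IsGalois ℚ L]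
    (hs : (f0.map (algebraMap ℚ L)).Splits)
    (hgen : ∀ σ τ : L ≃ₐ[ℚ] L, (∀ x, ev x fl = 0 → σ x = τ x) → σ = τ) :
    (∀ a b : L, ev a fl = 0 → ev b fl = 0 → ∃ g : L ≃ₐ[ℚ] L, g a = b) ∧
      IsSimpleGroup (L ≃ₐ[ℚ] L) ∧ Nat.card (L ≃ₐ[ℚ] L) = 7920 := by
  let φ : L →ₐ[ℚ] ℂ := IsAlgClosed.lift
  let _ : Algebra L ℂ := φ.toRingHom.toAlgebra
  have : IsScalarTower ℚ L ℂ := IsScalarTower.of_algebraMap_eq' (Subsingleton.elim _ _)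
  let conj : ℂ ≃ₐ[ℚ] ℂ := Complex.conjAe.restrictScalars ℚ
  let τ : L ≃ₐ[ℚ] L := conj.restrictNormal L
  have hτ : ∀ x, algebraMap L ℂ (τ x) = (starRingEnd ℂ) (algebraMap L ℂ x) := fun x =>
    conj.restrictNormal_commutes L x
  have hinj := (algebraMap L ℂ).injective
  obtain ⟨S, hS, hcard⟩ := rootsOf hs
  obtain ⟨r1, hr1a, hr1b, hr1⟩ := real_root (-1 / 10) 0 (by norm_num)
    (by simp only [fl, ev]; norm_num) (by simp only [fl, ev]; norm_num)
  obtain ⟨r2, hr2a, hr2b, hr2⟩ := real_root 2 3 (by norm_num)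
    (by simp only [fl, ev]; norm_num) (by simp only [fl, ev]; norm_num)
  obtain ⟨p, hpS, hp⟩ := extRoots S hS hcard (r1 : ℂ) (by rw [ev_ofReal, hr1]; simp)
  obtain ⟨q, hqS, hq⟩ := extRoots S hS hcard (r2 : ℂ) (by rw [ev_ofReal, hr2]; simp)
  obtain ⟨a, ha, han⟩ := exists_nonreal
  obtain ⟨b, hbS, hb⟩ := extRoots S hS hcard a ha
  refine gal_main hs hgen τ ?_ ?_ p q ((hS p).2 hpS) ((hS q).2 hqS) ?_ ?_ ?_
  · intro h
    apply han
    rw [← hb, ← hτ, h]; rfl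
  · apply AlgEquiv.ext
    intro x
    apply hinj
    change algebraMap L ℂ (τ (τ x)) = algebraMap L ℂ x
    rw [hτ, hτ, Complex.conj_conj]
  · rintro rfl
    have : (r1 : ℂ) = r2 := hp.symm.trans hq
    have : r1 = r2 := by exact_mod_cast this
    linarith
  · apply hinj
    rw [hτ, hp, Complex.conj_ofReal]
  · apply hinj
    rw [hτ, hq, Complex.conj_ofReal]

theorem gal_gen {L : Type*} [Field L] [Algebra ℚ L] [IsSplittingField ℚ L f0] :
    Irreducible f0 ∧ IsSimpleGroup (L ≃ₐ[ℚ] L) ∧ Nat.card (L ≃ₐ[ℚ] L) = 7920 := by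
  have hs : (f0.map (algebraMap ℚ L)).Splits := IsSplittingField.splits L f0
  have : FiniteDimensional ℚ L := IsSplittingField.finiteDimensional L f0
  have : IsGalois ℚ L := IsGalois.of_separable_splitting_field f0_sep
  obtain ⟨h1, h2, h3⟩ := gal_main2 (L := L) hs (by
    intro σ τ h
    have e : (σ : L →ₐ[ℚ] L) = (τ : L →ₐ[ℚ] L) := by
      apply AlgHom.ext_of_adjoin_eq_top (IsSplittingField.adjoin_rootSet L f0)
      intro x hx
      rw [mem_rootSet, f0_root] at hx
      exact h x hx.2
    apply AlgEquiv.ext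
    intro x
    exact DFunLike.congr_fun e x)
  refine ⟨?_, h2, h3⟩
  obtain ⟨S, hS, hcard⟩ := rootsOf hs
  obtain ⟨a, ha⟩ : S.Nonempty := by rw [← Finset.card_pos]; omega
  have haf := (hS a).2 ha
  have hint : IsIntegral ℚ a := Algebra.IsIntegral.isIntegral a
  have hdvd : minpoly ℚ a ∣ f0 := minpoly.dvd ℚ a ((f0_root a).2 haf)
  classical
  have hdeg : 12 ≤ (minpoly ℚ a).natDegree := by
    rw [← hcard]
    have hne := minpoly.ne_zero hint
    have hsub : S ⊆ ((minpoly ℚ a).aroots L).toFinset := by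
      intro b hb
      obtain ⟨g, hg⟩ := h1 a b haf ((hS b).2 hb)
      rw [Multiset.mem_toFinset, mem_aroots]
      refine ⟨hne, ?_⟩
      rw [← hg, aeval_algHom_apply, minpoly.aeval, map_zero]
    refine (Finset.card_le_card hsub).trans ?_
    exact (Multiset.toFinset_card_le _).trans ((card_roots' _).trans natDegree_map_le)
  have heq : minpoly ℚ a = f0 :=
    (eq_of_monic_of_dvd_of_natDegree_le (minpoly.monic hint) f0_monic hdvd (by rw [f0_natDegree]; exact hdeg)).symm
  rw [← heq]
  exact minpoly.irreducible hint

theorem gal_final : Irreducible f0 ∧ IsSimpleGroup f0.Gal ∧ Nat.card f0.Gal = 7920 :=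
  @gal_gen f0.SplittingField _ _ (IsSplittingField.splittingField f0)

end M11

namespace M11

section dedekind
variable {K : Type*} [Field K] (κ : K) (m Φ k h : ℤ[X]) (q : ℕ) [Fact q.Prime]

/-- reduction modulo `q` -/
noncomputable abbrev red (q : ℕ) : ℤ[X] →+* (ZMod q)[X] := mapRingHom (Int.castRingHom (ZMod q))

omit [Fact q.Prime] in
theorem red_zero {p : ℤ[X]} (hp : red q p = 0) : ∃ r : ℤ[X], p = C (q : ℤ) * r := by
  have : C (q : ℤ) ∣ p := by
    rw [C_dvd_iff_dvd_coeff]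
    intro i
    have := congrArg (fun f => coeff f i) hp
    simp only [red, coe_mapRingHom, coeff_map, coeff_zero] at this
    exact (ZMod.intCast_zmod_eq_zero_iff_dvd _ q).1 (by simpa using this)
  exact this

theorem red_surj (q : ℕ) (p : (ZMod q)[X]) : ∃ r : ℤ[X], red q r = p :=
  map_surjective _ (ZMod.ringHom_surjective _) p

theorem red_dvd (q : ℕ) {a b : ℤ[X]} (hp : red q a ∣ red q b) : ∃ r s : ℤ[X], b = a * r + C (q : ℤ) * s := by
  obtain ⟨c, hc⟩ := hp
  obtain ⟨r, rfl⟩ := red_surj q c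
  obtain ⟨s, hs⟩ := red_zero q (p := b - a * r) (by rw [map_sub, map_mul, hc, sub_self])
  exact ⟨r, s, by rw [← hs]; ring⟩

omit [Fact q.Prime] in
theorem aeC : aeval κ (C (q : ℤ)) = (q : K) := by
  rw [aeval_C]; simp

theorem int_ae {K : Type*} [Field K] (κ : K) (hκ : IsIntegral ℤ κ) (b : ℤ[X]) :
    IsIntegral ℤ (aeval κ b) := by
  rw [aeval_eq_sum_range]
  exact IsIntegral.sum _ fun i _ => (hκ.pow i).smul _

theorem lemR (hker : ∀ p : ℤ[X], aeval κ p = 0 → m ∣ p)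
    (hΦm : red q Φ ∣ red q m) (hsq : Squarefree (red q Φ))
    (c S : ℤ[X]) (hc : red q Φ ∣ red q c) (y : K) (hy : IsIntegral ℤ y)
    (hcy : aeval κ c * y = aeval κ S) : red q Φ ∣ red q S := by
  obtain ⟨p, hp, hpy⟩ := hy
  let P : ℤ[X][X] := p.map C
  have hPm : P.Monic := hp.map _
  let W : ℤ[X] := eval S (P.scaleRoots c)
  have hW : aeval κ W = 0 := by
    have h1 : eval₂ (aeval κ : ℤ[X] →ₐ[ℤ] K).toRingHom y P = 0 := by
      rw [eval₂_map, ← hpy]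
      congr 1
      ext z
      simp
    have h2 := scaleRoots_eval₂_eq_zero (aeval κ : ℤ[X] →ₐ[ℤ] K).toRingHom (s := c) h1
    have h3 : (aeval κ : ℤ[X] →ₐ[ℤ] K).toRingHom c * y = (aeval κ : ℤ[X] →ₐ[ℤ] K).toRingHom S := hcy
    rw [h3] at h2
    rw [← h2]
    exact (hom_eval₂ _ (RingHom.id _) (aeval κ : ℤ[X] →ₐ[ℤ] K).toRingHom S)
  have h4 : red q Φ ∣ red q W := hΦm.trans (_root_.map_dvd _ (hker W hW))
  have h5 : red q Φ ∣ red q W - (red q S) ^ P.natDegree := by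
    obtain ⟨t, ht⟩ := hc
    have e : W = ∑ i ∈ Finset.range (P.natDegree + 1), (P.coeff i * c ^ (P.natDegree - i)) * S ^ i := by
      simp only [W]
      rw [eval_eq_sum_range, natDegree_scaleRoots]
      simp [coeff_scaleRoots]
    rw [e, Finset.sum_range_succ, map_add]
    have : P.coeff P.natDegree = 1 := hPm
    rw [this]
    simp only [Nat.sub_self, pow_zero, mul_one, one_mul, map_pow, add_sub_cancel_right]
    rw [map_sum]
    apply Finset.dvd_sum
    intro i hi
    rw [map_mul, map_mul, map_pow, ht]
    apply Dvd.dvd.mul_right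
    apply Dvd.dvd.mul_left
    apply dvd_pow (Dvd.intro _ rfl)
    have := Finset.mem_range.1 hi
    omega
  have h6 : red q Φ ∣ (red q S) ^ P.natDegree := by
    have := dvd_sub h4 h5
    simpa using this
  by_cases hn : P.natDegree = 0
  · rw [hn, pow_zero] at h6
    exact (isUnit_of_dvd_one h6).dvd
  · exact (hsq.dvd_pow_iff_dvd hn).1 h6

variable [CharZero K]

theorem dedStep (hκ : IsIntegral ℤ κ) (hroot : aeval κ m = 0) (hker : ∀ p : ℤ[X], aeval κ p = 0 → m ∣ p)
    (hm : m = Φ * k + C (q : ℤ) * h) (hΦ : red q Φ ≠ 0)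
    (hsq : Squarefree (red q Φ))
    (hbez : ∃ s w v, red q h * s + red q k * w + red q Φ * v = 1)
    (x : K) (hx : IsIntegral ℤ x) (T S : ℤ[X]) (hT : (q : K) * x = aeval κ T)
    (hS : aeval κ Φ * x = aeval κ S) : ∃ Z : ℤ[X], x = aeval κ Z := by
  have hq0 : (q : K) ≠ 0 := Nat.cast_ne_zero.2 (Fact.out : q.Prime).ne_zero
  have hrm : red q m = red q Φ * red q k := by
    rw [hm, map_add, map_mul, map_mul]
    have : red q (C (q : ℤ)) = 0 := by simp [red]
    rw [this]; ring
  have hΦm : red q Φ ∣ red q m := by rw [hrm]; exact Dvd.intro _ rfl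
  have hrel : aeval κ Φ * aeval κ k = - ((q : K) * aeval κ h) := by
    have := hroot
    rw [hm] at this
    simp only [map_add, map_mul, aeC] at this
    linear_combination this
  have h1 : m ∣ Φ * T - C (q : ℤ) * S := by
    apply hker
    simp only [map_sub, map_mul, aeC]
    rw [← hT, ← hS]; ring
  have h2 : red q k ∣ red q T := by
    have := _root_.map_dvd (red q) h1
    rw [map_sub, map_mul, map_mul, hrm] at this
    have e : red q (C (q : ℤ)) = 0 := by simp [red]
    rw [e, zero_mul, sub_zero] at this
    exact (mul_dvd_mul_iff_left hΦ).1 this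
  obtain ⟨a, b, hab⟩ := red_dvd q h2
  have hx2 : IsIntegral ℤ (x - aeval κ b) := by
    apply hx.sub
    exact int_ae κ hκ b
  have hq2 : (q : K) * (x - aeval κ b) = aeval κ (k * a) := by
    rw [mul_sub, hT, hab]
    simp only [map_add, map_mul, aeC]
    ring
  have hπ : aeval κ Φ * (x - aeval κ b) = aeval κ (- (h * a)) := by
    apply mul_left_cancel₀ hq0
    have : (q : K) * (aeval κ Φ * (x - aeval κ b)) = aeval κ Φ * aeval κ (k * a) := by
      rw [← hq2]; ring
    rw [this]
    simp only [map_neg, map_mul]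
    linear_combination (aeval κ a) * hrel
  have r1 := lemR κ m Φ q hker hΦm hsq Φ _ dvd_rfl _ hx2 hπ
  have r2 := lemR κ m Φ q hker hΦm hsq (C (q : ℤ)) (k * a) (by simp [red]) _ hx2
    (by rw [← hq2]; rw [aeC])
  rw [map_neg, dvd_neg, map_mul] at r1
  rw [map_mul] at r2
  have r3 : red q Φ ∣ red q a := by
    obtain ⟨s, w, v, e⟩ := hbez
    have : red q a = s * (red q h * red q a) + w * (red q k * red q a) + red q Φ * (v * red q a) := by
      linear_combination (- red q a) * e
    rw [this]
    exact dvd_add (dvd_add (r1.mul_left _) (r2.mul_left _)) (Dvd.intro _ rfl)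
  obtain ⟨a2, a1, ha⟩ := red_dvd q r3
  refine ⟨b + k * a1 - h * a2, ?_⟩
  apply mul_left_cancel₀ hq0
  have e : (q : K) * x = aeval κ (k * a) + q * aeval κ b := by rw [← hq2]; ring
  rw [e, ha]
  simp only [map_add, map_sub, map_mul, aeC]
  linear_combination (aeval κ a2) * hrel

theorem dedekind (hκ : IsIntegral ℤ κ) (hroot : aeval κ m = 0) (hker : ∀ p : ℤ[X], aeval κ p = 0 → m ∣ p)
    (hm : m = Φ * k + C (q : ℤ) * h) (hΦ : red q Φ ≠ 0)
    (hsq : Squarefree (red q Φ))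
    (hbez : ∃ s w v, red q h * s + red q k * w + red q Φ * v = 1)
    (N : ℕ) (hk : red q k ∣ red q Φ ^ N)
    (x : K) (hx : IsIntegral ℤ x) (T : ℤ[X]) (hT : (q : K) * x = aeval κ T) :
    ∃ Z : ℤ[X], x = aeval κ Z := by
  have hq0 : (q : K) ≠ 0 := Nat.cast_ne_zero.2 (Fact.out : q.Prime).ne_zero
  have key : ∀ (j : ℕ) (x : K), IsIntegral ℤ x → (∃ T : ℤ[X], (q : K) * x = aeval κ T) →
      (∃ S : ℤ[X], aeval κ Φ ^ j * x = aeval κ S) → ∃ Z : ℤ[X], x = aeval κ Z := by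
    intro j
    induction j with
    | zero => intro x _ _ ⟨S, hS⟩; exact ⟨S, by simpa using hS⟩
    | succ j ih =>
      intro x hx ⟨T, hT⟩ ⟨S, hS⟩
      apply ih x hx ⟨T, hT⟩
      refine dedStep κ m Φ k h q hκ hroot hker hm hΦ hsq hbez _ ?_ (Φ ^ j * T) S ?_ ?_
      · rw [← map_pow]; exact (int_ae κ hκ _).mul hx
      · rw [map_mul, map_pow, ← hT]; ring
      · rw [← hS]; ring
  refine key (N + 1) x hx ⟨T, hT⟩ ?_
  have : red q m ∣ red q (Φ ^ (N + 1)) := by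
    have hrm : red q m = red q Φ * red q k := by
      rw [hm, map_add, map_mul, map_mul]
      have : red q (C (q : ℤ)) = 0 := by simp [red]
      rw [this]; ring
    rw [hrm, map_pow, pow_succ']
    exact mul_dvd_mul_left _ hk
  obtain ⟨r, s, e⟩ := red_dvd q this
  refine ⟨s * T, ?_⟩
  rw [← map_pow, e]
  simp only [map_add, map_mul, aeC, hroot]
  rw [← hT]; ring

end dedekind
end M11

namespace M11

def mL : List ℤ := [220, -432, -600, 840, 672, 18, -78, -12, 36, 18, 3, 3, 1]
def bL : List ℤ := [1310720, 27656192, 13418496, -3088384, -2819072, 388608, 183360, -33344, -3576, 1277, -108, 3]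
def AL : List ℤ := [162342037595596, 18688192578916, -415183874838152, -241938326833432, 6027540938936, 26374671561012, -3144842300056, -16450660689422, -7413673494052, -1670646455242, -1261750621767, -367027855717]
def PL : List (List ℤ) := [[5505024, 0, 0, 0, 0, 0, 0, 0, 0, 0, 0, 0],
  [1310720, 27656192, 13418496, -3088384, -2819072, 388608, 183360, -33344, -3576, 1277, -108, 3],
  [-12058624, -72482816, -24412160, 10371072, 4819968, -984576, -289216, 61216, 5452, -2060, 164, -4],
  [34340864, 173211648, 62324736, -20140032, -13885440, 2077440, 893888, -149760, -19104, 5434, -360, 6],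
  [-106692608, -507445248, -179732480, 75440128, 38409216, -8008960, -2436096, 552864, 40940, -17993, 1512, -39],
  [234881024, 1092091904, 351830016, -149110784, -79339520, 15257088, 5223424, -1055456, -111072, 39192, -3072, 72],
  [-602406912, -2783969280, -879624192, 426958848, 202758144, -49686528, -12117888, 3258912, 174240, -103110, 9624, -282],
  [1466957824, 6728450048, 1960869888, -1072881664, -455077888, 121377792, 28252928, -8275776, -321048, 251214, -25024, 786],
  [-3649044480, -16761225216, -5011636224, 2714058752, 1216706560, -323767808, -78668672, 23011040, 1128272, -794162, 82136, -2734],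
  [8633450496, 39329464320, 10433396736, -6640058368, -2552408064, 799976448, 144960256, -50471616, -1440168, 1564120, -167352, 5640],
  [-21140340736, -96084688896, -24539955200, 16694247424, 6233579520, -2065141760, -366665984, 138960768, 1421136, -3936336, 447216, -15728],
  [55127834624, 251440922624, 67296559104, -45647872000, -17241481216, 5712353280, 1109829120, -408764544, -9289200, 13411904, -1545232, 56064],
  [-124640034816, -562697601024, -127488294912, 102898335744, 34474844160, -13165108224, -1915011072, 839985792, 10908912, -26882100, 3193248, -117900]]

/-- each list in the chain represents `d` times a power of `κ` -/
def chain (d : ℤ) (b : List ℤ) : List (List ℤ) → Bool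
  | [] => true
  | P :: r => (match r with
    | [] => true
    | Q :: _ => isZ (addL 0 (smulL 0 (-d) Q) (mulM 0 12 FL.dropLast P b))) && chain d b r

def comb : List ℤ → List (List ℤ) → List ℤ
  | a :: l, P :: r => addL 0 (smulL 0 a P) (comb l r)
  | _, _ => []

theorem FLdrop {A : Type*} [CommRing A] (t : A) (h : ev t FL = 0) :
    t ^ 12 + ev t FL.dropLast = 0 := by
  rw [← h]
  simp only [FL, List.dropLast, ev]
  push_cast
  ring

theorem ev_comb {A : Type*} [Field A] [CharZero A] (t : A) (h : ev t FL = 0) (d : ℤ) (hd : d ≠ 0) (b : List ℤ)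
    (κ : A) (hκ : d * κ = ev t b) (L : List (List ℤ)) : ∀ (c : List ℤ) (x : A),
    c.length ≤ L.length → chain d b L = true → (∀ P ∈ L.head?, ev t P = d * x) →
    ev t (comb c L) = d * x * ev κ c := by
  have hd' : (d : A) ≠ 0 := Int.cast_ne_zero.2 hd
  induction L with
  | nil =>
    intro c x hc _ _
    have : c = [] := by simpa using hc
    subst this
    simp [comb, ev]
  | cons P r ih =>
    intro c x hc hch hx
    have hP : ev t P = d * x := hx P (by simp)
    cases c with
    | nil => simp [comb, ev]
    | cons a c =>
      simp only [chain, Bool.and_eq_true] at hch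
      simp only [comb, ev, ev_addL Int.cast_zero, ev_smulL Int.cast_zero, hP]
      rw [ih c (κ * x) (by simpa using hc) hch.2]
      · ring
      · intro Q hQ
        cases r with
        | nil => simp at hQ
        | cons Q' r =>
          have : Q' = Q := by simpa using hQ
          subst this
          have h1 := ev_isZ t _ hch.1
          simp only [ev_addL Int.cast_zero, ev_smulL Int.cast_zero,
            ev_mulM Int.cast_zero t 12 _ (FLdrop t h), hP, ← hκ] at h1
          apply mul_left_cancel₀ hd'
          push_cast at h1
          linear_combination -h1

theorem chain_ok : chain 5505024 bL PL = true := by decide +kernel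
theorem mL_ok : isZ (comb mL PL) = true := by decide +kernel
theorem AL_ok : isZ (addL 0 [0, -(4056751214947 * 5505024)] (comb AL PL)) = true := by
  decide +kernel

theorem kappa_exists {K : Type*} [Field K] [CharZero K] (t : K) (ht : ev t FL = 0) :
    ∃ κ : K, ev κ mL = 0 ∧ 4056751214947 * t = ev κ AL := by
  have hd : ((5505024 : ℤ) : K) ≠ 0 := Int.cast_ne_zero.2 (by norm_num)
  let κ : K := ev t bL / ((5505024 : ℤ) : K)
  have hκ : ((5505024 : ℤ) : K) * κ = ev t bL := mul_div_cancel₀ _ hd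
  have hP : ∀ P ∈ PL.head?, ev t P = ((5505024 : ℤ) : K) * 1 := by
    intro P hP
    simp only [PL, List.head?_cons, Option.mem_some_iff] at hP
    subst hP
    simp [ev]
  refine ⟨κ, ?_, ?_⟩
  · have h1 := ev_isZ t _ mL_ok
    rw [ev_comb t ht 5505024 (by norm_num) bL κ hκ PL mL 1 (by decide) chain_ok hP] at h1
    exact (mul_eq_zero.1 h1).resolve_left (by simpa using hd)
  · have h1 := ev_isZ t _ AL_ok
    rw [ev_addL Int.cast_zero, ev_comb t ht 5505024 (by norm_num) bL κ hκ PL AL 1 (by decide) chain_ok hP] at h1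
    apply mul_left_cancel₀ hd
    simp only [ev] at h1
    push_cast at h1 ⊢
    linear_combination -h1

theorem mL_monic (R : Type*) [CommRing R] [Nontrivial R] : (pol R mL).Monic :=
  monic_of_natDegree_le_of_coeff_eq_one 12 (pol_natDegree_le _ _ (by decide))
      (by rw [pol_coeff]; simp [mL])

theorem mL_natDegree (R : Type*) [CommRing R] [Nontrivial R] : (pol R mL).natDegree = 12 := by
  apply le_antisymm (pol_natDegree_le _ _ (by decide))
  apply le_natDegree_of_ne_zero
  rw [pol_coeff]; simp [mL]

section
variable {K : Type*} [Field K] [NumberField K]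

theorem finrank12 (hirr : Irreducible f0) (e : AdjoinRoot f0 ≃ₐ[ℚ] K) :
    Module.finrank ℚ K = 12 := by
  rw [← LinearEquiv.finrank_eq e.toLinearEquiv, (AdjoinRoot.powerBasis f0_ne).finrank,
    AdjoinRoot.powerBasis_dim, f0_natDegree]

theorem kappa_full (hirr : Irreducible f0) (hfr : Module.finrank ℚ K = 12) (α : K)
    (hα : ev α fl = 0) : ∃ κ t : K, ev t FL = 0 ∧ 4056751214947 * t = ev κ AL ∧ ev κ mL = 0 ∧
      Algebra.adjoin ℚ {κ} = ⊤ ∧ minpoly ℚ κ = pol ℚ mL := by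
  have ht : ev (4 * α) FL = 0 := by rw [FL_ev, hα, mul_zero]
  obtain ⟨κ, hκ, hA⟩ := kappa_exists (4 * α) ht
  have hint : IsIntegral ℚ κ := Algebra.IsIntegral.isIntegral κ
  have hαi : IsIntegral ℚ α := Algebra.IsIntegral.isIntegral α
  have hmα : minpoly ℚ α = f0 :=
    (minpoly.eq_of_irreducible_of_monic hirr ((f0_root α).2 hα) f0_monic).symm
  have hmem : α ∈ Algebra.adjoin ℚ {κ} := by
    have h1 : ev κ AL ∈ Algebra.adjoin ℚ {κ} := by
      rw [← pol_eval (R := ℚ)]; exact aeval_mem_adjoin_singleton ℚ κ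
    have : α = (1 / (4 * 4056751214947) : ℚ) • ev κ AL := by
      rw [← hA, Algebra.smul_def]
      simp only [map_div₀, map_mul, map_one, map_ofNat]
      field_simp
    rw [this]
    exact Subalgebra.smul_mem _ h1 _
  have htop : IntermediateField.adjoin ℚ {κ} = ⊤ := by
    have h1 : IntermediateField.adjoin ℚ {α} ≤ IntermediateField.adjoin ℚ {κ} := by
      rw [IntermediateField.adjoin_le_iff, Set.singleton_subset_iff]
      exact IntermediateField.algebra_adjoin_le_adjoin ℚ _ hmem
    have h2 : IntermediateField.adjoin ℚ {α} = ⊤ := by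
      apply IntermediateField.eq_of_le_of_finrank_le le_top
      rw [IntermediateField.adjoin.finrank hαi, hmα, f0_natDegree, IntermediateField.finrank_top', hfr]
    rw [h2] at h1
    exact top_le_iff.1 h1
  refine ⟨κ, 4 * α, ht, hA, hκ, ?_, ?_⟩
  · rw [← IntermediateField.adjoin_simple_toSubalgebra_of_isAlgebraic hint.isAlgebraic, htop,
      IntermediateField.top_toSubalgebra]
  · have hdeg : (minpoly ℚ κ).natDegree = 12 := by
      rw [← IntermediateField.adjoin.finrank hint, htop, IntermediateField.finrank_top', hfr]
    refine (eq_of_monic_of_dvd_of_natDegree_le (minpoly.monic hint) (mL_monic ℚ)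
      (minpoly.dvd ℚ κ ?_) ?_).symm
    · rw [pol_eval, hκ]
    · rw [mL_natDegree, hdeg]

theorem kappa_int {κ : K} (hκ : ev κ mL = 0) : IsIntegral ℤ κ :=
  ⟨pol ℤ mL, mL_monic ℤ, by rw [← aeval_def, pol_eval]; exact hκ⟩

theorem kappa_ker {κ : K} (hκ : ev κ mL = 0) (hm : minpoly ℚ κ = pol ℚ mL) (p : ℤ[X])
    (hp : aeval κ p = 0) : pol ℤ mL ∣ p := by
  have h1 : minpoly ℤ κ = pol ℤ mL := by
    apply map_injective (algebraMap ℤ ℚ) (RingHom.injective_int _)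
    rw [← minpoly.isIntegrallyClosed_eq_field_fractions' ℚ (kappa_int hκ), hm, pol_map]
  rw [← h1]
  exact minpoly.isIntegrallyClosed_dvd (kappa_int hκ) hp

end
end M11

namespace M11

def detRL : List (List ℤ) := [[1],
  [-55, 9],
  [-12595, 4327, 9064],
  [-5020730, 1095023, 4590384, 3496588],
  [-4373937865, 8555693864, 1104558458, -1985523486, 1570541798],
  [-1926052200160, 1417517937151, 3501715085072, 321238310026, 671539308882, 517085776150],
  [9732531468926750, -8106878849219060, -29897677252684814, 16642907202532402, 3326011272737131, -2393758914566263, 3091506442159045],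
  [-32438947349631175320, 46591833780509522842, 84996465146806236980, -94284182452631119234, -9514320051385719046, 2933595813919978037, -15500395170061545809, 818419379183907863],
  [193109130261764060208370, -78707710080958876432422, -518982423369055276464930, -163139516495091420670356, 93964627837010864763461, 62666942329885816503708, 4110854981596725933219, 17747054497445852681142, 6376053723218721384625],
  [-6218359294540546885915260, 4606425473188172154643106, 14928693414181183961343780, -253627259407359153953226, -1353023377643617467440340, -1186154305112693490852455, 161352472383470750665863, -110765740389953176698924, -121786710441267572909997, 38281601542531547845499],
  [77320590895617873359937040, -235306796833684155878453924, -16432818942905963112821330, 398442806777256375591159804, -89612657155475053085593390, 6137336744997433931272940, -20985417017119664548092817, 11286536788550001450013641, 6640185585210089063447008, -2458400017727661437298431, 1785408578118858843076345],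
  [910522058857347759057618240, -2455865748352055204788395664, -799534241264282224415720188, 4289700002931260434351665026, -215093601583430125417061052, -81936047520767550081360290, -205042880249707480719895436, 85010897240559119565741385, 104546738603953932539705391, -12050624448201460654842544, 14935985868152963878940375, 3736802545456688693928431]]
def detTL : List (List ℤ) := [[-432, -1200, 2520, 2688, 90, -468, -84, 288, 162, 30, 33, 12],
  [108768, -84600, -215880, -53334, 24606, 8832, -15300, -10206, -2136, -1869, -687],
  [20979528, 10657800, -74646318, -42889350, -180024, 547908, -1140726, -1427268, -849477, -136929],
  [18846501576, -9045989892, -41792194530, -18508965900, -530117484, 933037452, -224276670, -724983720, -238578429],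
  [-7756286642250, 17946856336956, -1330837077480, -8634501363288, 145936073694, 1116436626978, 384657118023, 131321740920],
  [3709807730590854, -2250999026272020, -7594636346123592, -2874634564550904, 708757906595502, 496314201700482, 53086535285055],
  [-9821032550206894356, 28134847921344794820, -10011760082704473462, -21120743098717983864, -968760582773613918, 1769397128161700472],
  [-76512644678624656615500, 107829978987018492011556, 93110595588061602264270, -8616215658612332764512, -10533225287005312375002],
  [66839676293260082538241254, -178542904806912260250069570, -202849682281174338401412108, -49351160583035431194582018],
  [3117323377395527540011298370, 2840824576992428788146789456, 613644325926130940392954872],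
  [6524457244367378459599040526, 7226234158022405396884552032],
  [28734324313274535200987564514]]
def rowL : ℕ → List ℤ
  | 0 => der mL
  | j + 1 => redX 0 12 mL.dropLast (rowL j)

def fM (j i : Fin 12) : ℤ := (rowL j).getD i 0
def fR (j i : Fin 12) : ℤ := (detRL.getD j []).getD i 0
def fT (j i : Fin 12) : ℤ := if i < j then 0 else (detTL.getD j []).getD (i - j) 0
def detM : Matrix (Fin 12) (Fin 12) ℤ := Matrix.of fM
def detR : Matrix (Fin 12) (Fin 12) ℤ := Matrix.of fR
def detT : Matrix (Fin 12) (Fin 12) ℤ := Matrix.of fT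

theorem rowL_len : ∀ j : Fin 12, (rowL j).length = 12 := by decide +kernel

theorem detRM : ∀ j i : Fin 12, ∑ k, fR j k * fM k i = fT j i := by
  decide +kernel

theorem detR_tri : ∀ i j : Fin 12, i < j → fR i j = 0 := by decide +kernel

theorem det_prod : (∏ i, fR i i) * (2 ^ 8 * 3 ^ 16 * 97 ^ 4 * (2 ^ 5 * 4056751214947) ^ 2) = ∏ i, fT i i ∧
    (∏ i, fR i i) ≠ 0 := by
  decide +kernel

theorem detM_det : detM.det = 2 ^ 8 * 3 ^ 16 * 97 ^ 4 * (2 ^ 5 * 4056751214947) ^ 2 := by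
  have h1 : detR * detM = detT := by ext j i; rw [Matrix.mul_apply]; exact detRM j i
  have h2 := congrArg Matrix.det h1
  rw [Matrix.det_mul] at h2
  have h3 : detR.det = ∏ i, fR i i := Matrix.det_of_isLowerTriangular _ (by
    intro i j hij
    exact detR_tri i j hij)
  have h4 : detT.det = ∏ i, fT i i := Matrix.det_of_isUpperTriangular (by
    intro i j hij
    have : j < i := hij
    simp [detT, fT, this])
  rw [h3, h4, ← det_prod.1] at h2
  exact mul_left_cancel₀ det_prod.2 h2

theorem ev_sum {R : Type*} [CommRing R] (x : R) (l : List ℤ) (n : ℕ) (h : l.length ≤ n) :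
    ev x l = ∑ i : Fin n, ((l.getD i 0 : ℤ) : R) * x ^ (i : ℕ) := by
  induction l generalizing n with
  | nil => simp [ev]
  | cons a l ih =>
    cases n with
    | zero => simp at h
    | succ n =>
      rw [Fin.sum_univ_succ, ev, ih n (by simpa using h), Finset.mul_sum]
      simp only [Fin.val_zero, List.getD_cons_zero, pow_zero, mul_one, Fin.val_succ,
        List.getD_cons_succ, pow_succ]
      congr 1
      exact Finset.sum_congr rfl fun i _ => by ring

section
variable {K : Type*} [Field K] [NumberField K]

theorem mLdrop {κ : K} (hκ : ev κ mL = 0) : κ ^ 12 + ev κ mL.dropLast = 0 := by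
  rw [← hκ]
  simp only [mL, List.dropLast, ev]
  push_cast
  ring

theorem rowL_ev {κ : K} (hκ : ev κ mL = 0) (j : ℕ) :
    ev κ (rowL j) = ev κ (der mL) * κ ^ j := by
  induction j with
  | zero => simp [rowL]
  | succ j ih =>
    rw [rowL, ev_redX Int.cast_zero κ 12 _ (mLdrop hκ), ih]; ring

theorem discr_kappa {κ : K} (hκ : ev κ mL = 0) (htop : Algebra.adjoin ℚ {κ} = ⊤)
    (hm : minpoly ℚ κ = pol ℚ mL) :
    Algebra.discr ℚ (fun i : Fin 12 => κ ^ (i : ℕ)) =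
      2 ^ 8 * 3 ^ 16 * 97 ^ 4 * (2 ^ 5 * 4056751214947) ^ 2 := by
  have hint : IsIntegral ℚ κ := Algebra.IsIntegral.isIntegral κ
  let pb := PowerBasis.ofAdjoinEqTop hint htop
  have hdim : pb.dim = 12 := by
    rw [PowerBasis.ofAdjoinEqTop_dim, hm, mL_natDegree]
  have hgen : pb.gen = κ := PowerBasis.ofAdjoinEqTop_gen hint htop
  let b : Module.Basis (Fin 12) ℚ K := pb.basis.reindex (finCongr hdim)
  have hb : ∀ i, b i = κ ^ (i : ℕ) := by
    intro i
    simp [b, hgen]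
  have h1 : Algebra.discr ℚ (fun i : Fin 12 => κ ^ (i : ℕ)) = Algebra.discr ℚ pb.basis := by
    rw [← Algebra.discr_reindex ℚ pb.basis (finCongr hdim)]
    congr 1
    ext i
    simp [hgen]
  rw [h1, Algebra.discr_powerBasis_eq_norm, hgen, hm, pol_der, pol_eval, PowerBasis.finrank pb, hdim, Algebra.norm_eq_matrix_det b]
  have h2 : Algebra.leftMulMatrix b (ev κ (der mL)) = (detM.map (Int.cast : ℤ → ℚ)).transpose := by
    ext i j
    rw [Algebra.leftMulMatrix_eq_repr_mul, hb, ← rowL_ev hκ, ev_sum κ _ 12 (rowL_len j).le]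
    have : ∑ i : Fin 12, (((rowL j).getD i 0 : ℤ) : K) * κ ^ (i : ℕ) =
        ∑ i : Fin 12, (((rowL j).getD i 0 : ℤ) : ℚ) • b i := by
      refine Finset.sum_congr rfl fun i _ => ?_
      rw [hb, Algebra.smul_def]; simp
    rw [this, b.repr_sum_self]
    rfl
  rw [h2, Matrix.det_transpose]
  have h3 : (detM.map (Int.cast : ℤ → ℚ)).det = ((detM.det : ℤ) : ℚ) := 
    (RingHom.map_det (Int.castRingHom ℚ) detM).symm
  rw [h3, detM_det]
  norm_num

end
end M11

namespace M11
open NumberField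

section
variable {K : Type*} [Field K] [NumberField K]

theorem lattice (hfr : Module.finrank ℚ K = 12) :
    ∃ ω : Fin 12 → K, (∀ i, IsIntegral ℤ (ω i)) ∧
      (∀ x : K, IsIntegral ℤ x → ∃ c : Fin 12 → ℤ, x = ∑ j, (c j : K) * ω j) ∧
      Algebra.discr ℚ ω = ((NumberField.discr K : ℤ) : ℚ) := by
  have hcard : Fintype.card (Module.Free.ChooseBasisIndex ℤ (𝓞 K)) = Fintype.card (Fin 12) := by
    rw [← Module.finrank_eq_card_chooseBasisIndex, RingOfIntegers.rank, hfr, Fintype.card_fin]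
  let e := Fintype.equivOfCardEq hcard
  let B := (RingOfIntegers.basis K).reindex e
  refine ⟨fun i => (B i : K), fun i => RingOfIntegers.isIntegral_coe _, ?_, ?_⟩
  · intro x hx
    let y : 𝓞 K := ⟨x, hx⟩
    refine ⟨fun j => B.repr y j, ?_⟩
    have h := B.sum_repr y
    have h2 := congrArg (fun z : 𝓞 K => (z : K)) h
    simp only [map_sum, zsmul_eq_mul, map_mul, map_intCast] at h2
    exact h2.symm
  · rw [NumberField.coe_discr, ← Algebra.discr_reindex ℚ (integralBasis K) e]
    congr 1
    ext i
    simp [B, integralBasis_apply]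

theorem change (ω lam : Fin 12 → K) (M : Matrix (Fin 12) (Fin 12) ℚ)
    (h : ∀ i, lam i = ∑ j, (M i j : K) * ω j) :
    Algebra.discr ℚ lam = M.det ^ 2 * Algebra.discr ℚ ω := by
  rw [← Algebra.discr_of_matrix_mulVec]
  congr 1
  ext i
  rw [h, Matrix.mulVec, dotProduct]
  simp

theorem changeZ (ω lam : Fin 12 → K) (M : Matrix (Fin 12) (Fin 12) ℤ)
    (h : ∀ i, lam i = ∑ j, (M i j : K) * ω j) :
    Algebra.discr ℚ lam = (M.det : ℚ) ^ 2 * Algebra.discr ℚ ω := by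
  rw [change ω lam (M.map (Int.cast : ℤ → ℚ)) (by intro i; rw [h]; simp)]
  congr 2
  exact (RingHom.map_det (Int.castRingHom ℚ) M).symm
end
end M11

namespace M11
open NumberField

/-- coefficients of `2 N β` -/
def beL : List ℤ := [-328621526889430811146790496, -37829649492176309893206816, 840437639627637217713701952, 489744637646665889355479232, -12201274149804290581542336, -53389035692515765107921312, 6365959758650386251531456, 33300316505602666975247472, 15007158586638075553880352, 1152939982250758543526619, 325230935811352719950019, 1]
def lamL (i : Fin 12) : List ℤ :=
  if i.val = 11 then beL else if i.val < 7 then List.replicate i.val 0 ++ [1]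
  else List.replicate (i.val - 2) 0 ++ [3, 3, 1]
def lamD (i : Fin 12) : ℤ := if i.val = 11 then 2 * 4056751214947 else if i.val < 7 then 1 else 2

theorem lam_tri : ∀ i j : Fin 12, i < j → (lamL i).getD j 0 = 0 := by decide +kernel
theorem lam_diag : ∀ i : Fin 12, (lamL i).getD i 0 = 1 := by decide +kernel
theorem lam_len : ∀ i : Fin 12, (lamL i).length ≤ 12 := by decide +kernel
theorem lam_D : ∏ i, lamD i = 2 ^ 5 * 4056751214947 := by decide +kernel
theorem lamD_ne : ∀ i, lamD i ≠ 0 := by decide +kernel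

section
variable {K : Type*} [Field K] [NumberField K]

theorem ev_rep (x : K) (n : ℕ) (l : List ℤ) : ev x (List.replicate n 0 ++ l) = x ^ n * ev x l := by
  rw [ev_append, List.length_replicate]
  have : ev x (List.replicate n 0) = 0 := by
    induction n with
    | zero => rfl
    | succ n ih => simp [List.replicate_succ, ev, ih]
  rw [this, zero_add]

theorem w_int {κ : K} (hκ : ev κ mL = 0) : IsIntegral ℤ (κ ^ 5 * (κ ^ 2 + 3 * κ + 3) / 2) := by
  let k : 𝓞 K := ⟨κ, kappa_int hκ⟩
  have hk : algebraMap (𝓞 K) K k = κ := rfl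
  apply isIntegral_trans (R := ℤ) (A := 𝓞 K)
  obtain ⟨a, ha⟩ : ∃ a : 𝓞 K, a = 9 - 39 * k - 6 * k ^ 2 + 18 * k ^ 3 + 9 * k ^ 4 := ⟨_, rfl⟩
  obtain ⟨b, hb⟩ : ∃ b : 𝓞 K, b =
    (55 - 108 * k - 150 * k ^ 2 + 210 * k ^ 3 + 168 * k ^ 4) * (k ^ 2 + 3 * k + 3) := ⟨_, rfl⟩
  refine ⟨X ^ 2 + C a * X + C b, ?_, ?_⟩
  · monicity!
  · simp only [eval₂_add, eval₂_mul, eval₂_pow, eval₂_X, eval₂_C]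
    rw [ha, hb]
    simp only [map_add, map_sub, map_mul, map_pow, hk, map_ofNat]
    simp only [mL, ev] at hκ
    push_cast at hκ
    linear_combination (κ ^ 2 + 3 * κ + 3) / 4 * hκ

theorem t_int {t : K} (ht : ev t FL = 0) : IsIntegral ℤ t := by
  have hm : (pol ℤ FL).Monic :=
    monic_of_natDegree_le_of_coeff_eq_one 12 (pol_natDegree_le _ _ (by decide))
      (by rw [pol_coeff]; simp [FL])
  exact ⟨pol ℤ FL, hm, by rw [← aeval_def, pol_eval]; exact ht⟩

theorem lam_int {κ t : K} (hκ : ev κ mL = 0) (ht : ev t FL = 0)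
    (hA : 4056751214947 * t = ev κ AL) (i : Fin 12) :
    IsIntegral ℤ (ev κ (lamL i) / (lamD i : K)) := by
  have hw := w_int hκ
  have hk := kappa_int hκ
  by_cases h1 : i.val = 11
  · simp only [lamL, lamD, h1, if_true]
    have : ev κ beL / ((2 * 4056751214947 : ℤ) : K) =
        ((-1012127024388 : ℤ) : K) * t + ((-183141036653 : ℤ) : K) * (κ ^ 4 * (κ ^ 5 * (κ ^ 2 + 3 * κ + 3) / 2)) := by
      have hN : ((2 * 4056751214947 : ℤ) : K) ≠ 0 := Int.cast_ne_zero.2 (by norm_num)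
      rw [div_eq_iff hN]
      simp only [AL, ev] at hA
      simp only [beL, ev]
      push_cast at hA ⊢
      linear_combination (-2 * -1012127024388) * hA
    rw [this]
    exact ((isIntegral_algebraMap (R := ℤ) (x := -1012127024388)).mul (t_int ht)).add
      ((isIntegral_algebraMap (R := ℤ) (x := -183141036653)).mul ((hk.pow 4).mul hw))
  · by_cases h2 : i.val < 7
    · simp only [lamL, lamD, h1, h2, if_true, if_false, ev_rep]
      simpa [ev] using hk.pow i.val
    · simp only [lamL, lamD, h1, h2, if_false, ev_rep]
      have : κ ^ (i.val - 2) * ev κ [3, 3, 1] / ((2 : ℤ) : K) =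
          κ ^ (i.val - 7) * (κ ^ 5 * (κ ^ 2 + 3 * κ + 3) / 2) := by
        have e : i.val - 2 = (i.val - 7) + 5 := by omega
        rw [e, pow_add]
        simp only [ev]
        push_cast
        ring
      rw [this]
      exact (hk.pow _).mul hw

theorem upper (hfr : Module.finrank ℚ K = 12) {κ t : K} (hκ : ev κ mL = 0) (ht : ev t FL = 0)
    (hA : 4056751214947 * t = ev κ AL) (htop : Algebra.adjoin ℚ {κ} = ⊤)
    (hm : minpoly ℚ κ = pol ℚ mL) :
    ∃ c : ℤ, 2 ^ 8 * 3 ^ 16 * 97 ^ 4 = c ^ 2 * NumberField.discr K := by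
  obtain ⟨ω, -, hω, hd⟩ := lattice hfr
  choose M hM using fun i => hω _ (lam_int hκ ht hA i)
  have h1 := changeZ ω _ (Matrix.of M) hM
  let P : Matrix (Fin 12) (Fin 12) ℚ := Matrix.of fun i j => ((lamL i).getD j 0 : ℚ) / (lamD i : ℚ)
  have h2 := change (fun i : Fin 12 => κ ^ (i : ℕ)) (fun i => ev κ (lamL i) / (lamD i : K)) P (by
    intro i
    rw [ev_sum κ _ 12 (lam_len i), Finset.sum_div]
    refine Finset.sum_congr rfl fun j _ => ?_
    simp [P]
    ring)
  have h3 : P.det = (2 ^ 5 * 4056751214947)⁻¹ := by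
    rw [Matrix.det_of_isLowerTriangular P (by
      intro i j hij
      simp only [P, Matrix.of_apply]
      rw [lam_tri i j hij]; simp)]
    simp only [P, Matrix.of_apply]
    simp only [lam_diag, Int.cast_one, one_div]
    rw [Finset.prod_inv_distrib]
    congr 1
    exact_mod_cast lam_D
  rw [h2, h3, hd, discr_kappa hκ htop hm] at h1
  refine ⟨(Matrix.of M).det, ?_⟩
  have : (2 ^ 8 * 3 ^ 16 * 97 ^ 4 : ℚ) = ((Matrix.of M).det : ℚ) ^ 2 * ((NumberField.discr K : ℤ) : ℚ) := by
    rw [← h1]; norm_num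
  exact_mod_cast this

theorem qpart (q : ℕ) [Fact q.Prime] (hfr : Module.finrank ℚ K = 12) {κ : K} (hκ : ev κ mL = 0)
    (htop : Algebra.adjoin ℚ {κ} = ⊤) (hm : minpoly ℚ κ = pol ℚ mL)
    (hded : ∀ x : K, IsIntegral ℤ x → ∀ T : ℤ[X], (q : K) * x = aeval κ T → ∃ Z : ℤ[X], x = aeval κ Z)
    (e : ℕ) (he : (q : ℤ) ^ e ∣ 2 ^ 8 * 3 ^ 16 * 97 ^ 4 * (2 ^ 5 * 4056751214947) ^ 2) :
    (q : ℤ) ^ e ∣ NumberField.discr K := by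
  obtain ⟨ω, hωi, hω, hd⟩ := lattice hfr
  choose M hM using fun i : Fin 12 => hω _ ((kappa_int hκ).pow (i : ℕ))
  have h1 := changeZ ω _ (Matrix.of M) hM
  rw [hd, discr_kappa hκ htop hm] at h1
  have h2 : (2 ^ 8 * 3 ^ 16 * 97 ^ 4 * (2 ^ 5 * 4056751214947) ^ 2 : ℤ) =
    (Matrix.of M).det ^ 2 * NumberField.discr K := by exact_mod_cast h1
  rw [h2] at he
  have hqp : Prime (q : ℤ) := Nat.prime_iff_prime_int.1 Fact.out
  have hnd : ¬ (q : ℤ) ∣ (Matrix.of M).det := by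
    intro hdvd
    have h0 : ((Matrix.of M).map (Int.castRingHom (ZMod q))).det = 0 := by
      have := RingHom.map_det (Int.castRingHom (ZMod q)) (Matrix.of M)
      rw [RingHom.mapMatrix_apply] at this
      rw [← this]
      exact (ZMod.intCast_zmod_eq_zero_iff_dvd _ q).2 hdvd
    obtain ⟨v, hv0, hv⟩ := Matrix.exists_vecMul_eq_zero_iff.2 h0
    choose V hV using fun i => ZMod.intCast_surjective (v i)
    have hc : ∀ j, ∃ c : ℤ, ∑ i, V i * M i j = q * c := by
      intro j
      have := congrFun hv j
      rw [Matrix.vecMul, dotProduct] at this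
      have h : ((∑ i, V i * M i j : ℤ) : ZMod q) = 0 := by
        refine Eq.trans ?_ this
        push_cast
        exact Finset.sum_congr rfl fun i _ => by simp [hV]
      exact (ZMod.intCast_zmod_eq_zero_iff_dvd _ q).1 h
    choose c hc using hc
    let T : ℤ[X] := ∑ i : Fin 12, C (V i) * X ^ (i : ℕ)
    have hx : (q : K) * ∑ j, (c j : K) * ω j = aeval κ T := by
      have e1 : aeval κ T = ∑ i : Fin 12, (V i : K) * κ ^ (i : ℕ) := by
        simp [T]
      rw [e1, Finset.mul_sum]
      simp_rw [hM, Finset.mul_sum]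
      rw [Finset.sum_comm]
      refine Finset.sum_congr rfl fun j _ => ?_
      have := congrArg (fun z : ℤ => (z : K)) (hc j)
      simp only [Int.cast_sum, Int.cast_mul, Int.cast_natCast] at this
      rw [← mul_assoc, ← this, Finset.sum_mul]
      exact Finset.sum_congr rfl fun i _ => by ring
    obtain ⟨Z, hZ⟩ := hded (∑ j, (c j : K) * ω j) (IsIntegral.sum _ fun j _ =>
      (isIntegral_algebraMap (R := ℤ) (x := c j)).mul (hωi j)) T hx
    have h3 : pol ℤ mL ∣ T - C (q : ℤ) * Z := by
      apply kappa_ker hκ hm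
      rw [map_sub, map_mul, aeC, ← hx, hZ, sub_self]
    have h4 := _root_.map_dvd (red q) h3
    have h5 : red q (T - C (q : ℤ) * Z) = ∑ i : Fin 12, C (v i) * X ^ (i : ℕ) := by
      rw [map_sub, map_mul]
      have e : red q (C (q : ℤ)) = 0 := by simp [red]
      rw [e, zero_mul, sub_zero]
      simp only [T, map_sum, map_mul, map_pow]
      refine Finset.sum_congr rfl fun i _ => ?_
      simp [red, ← hV]
    rw [h5] at h4
    have h6 : red q (pol ℤ mL) = pol (ZMod q) mL := pol_map _ _
    rw [h6] at h4
    have h7 : (∑ i : Fin 12, C (v i) * X ^ (i : ℕ) : (ZMod q)[X]) = 0 := by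
      refine eq_zero_of_dvd_of_degree_lt h4 ?_
      rw [degree_eq_natDegree (mL_monic _).ne_zero, mL_natDegree]
      refine (degree_sum_le _ _).trans_lt ?_
      rw [Finset.sup_lt_iff (by exact WithBot.bot_lt_coe 12)]
      intro i _
      refine (degree_C_mul_X_pow_le _ _).trans_lt ?_
      exact_mod_cast i.2
    apply hv0
    ext i
    have := congrArg (fun f => coeff f (i : ℕ)) h7
    simp only [finsetSum_coeff, coeff_C_mul_X_pow, coeff_zero] at this
    rw [Finset.sum_eq_single i] at this
    · simpa using this
    · intro b _ hb
      rw [if_neg]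
      intro h; exact hb (Fin.ext h.symm)
    · simp
  have hcop : IsCoprime ((q : ℤ) ^ e) ((Matrix.of M).det ^ 2) :=
    IsCoprime.pow ((Prime.coprime_iff_not_dvd hqp).2 hnd)
  exact hcop.dvd_of_dvd_mul_left he

end
end M11

namespace M11
open NumberField
def Ph3L : List ℤ := [1, 0, 0, 0, 1]
def k3L : List ℤ := [1, 0, 0, 0, 2, 0, 0, 0, 1]
def h3L : List ℤ := [73, -144, -200, 280, 223, 6, -26, -4, 11, 6, 1, 1]
def a3L : List ℤ := [1]
def b3L : List ℤ := [0, -1]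
def s3L : List ℤ := [1, 0, 1]
def w3L : List ℤ := []
def v3L : List ℤ := [0, 0, 1, -1, 1, -1, 0, -1, -1, -1]
def g3L : List ℤ := [1]
def Ph97L : List ℤ := [-43, 32, 0, 34, 2, 45, -41, -10, 1]
def k97L : List ℤ := [40, 15, -20, 13, 1]
def h97L : List ℤ := [20, -11, -20, 7, -3, -12, 5, 19, -13, 3, 2]
def a97L : List ℤ := [36, 48, -40, -33, 35, -40, 29]
def b97L : List ℤ := [9, -20, 9, 28, -42, -24, -42, -40]
def s97L : List ℤ := [-32, -48, -41, 17]
def w97L : List ℤ := [33, -19, -36, 23, -2, -41, 35, 13, -12, -34]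
def v97L : List ℤ := []
def g97L : List ℤ := [45, 30, -13, -23, 1]

def dedChk (q : ℤ) (Φ k h a b s w v g : List ℤ) (n : ℕ) : Bool :=
  isZ (addL 0 (smulL 0 (-1) mL) (addL 0 (mulL 0 Φ k) (smulL 0 q h))) &&
  (isZ (addL q [-1] (addL q (mulL q a Φ) (mulL q b (der Φ)))) &&
  (isZ (addL q [-1] (addL q (mulL q h s) (addL q (mulL q k w) (mulL q Φ v)))) &&
  isZ (addL q (smulL q (-1) (mulL q k g)) (Nat.rec [1] (fun _ r => mulL q Φ r) n))))

theorem ev_npow {R : Type*} [CommRing R] {q : ℤ} (hq : (q : R) = 0) (x : R) (Φ : List ℤ) (n : ℕ) :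
    ev x (Nat.rec [1] (fun _ r => mulL q Φ r) n) = ev x Φ ^ n := by
  induction n with
  | zero => simp [ev]
  | succ n ih => 
    have := ev_mulL hq x Φ (Nat.rec [1] (fun _ r => mulL q Φ r) n)
    rw [ih] at this
    rw [pow_succ']; exact this

section
variable {K : Type*} [Field K] [NumberField K]

theorem ded_of (q : ℕ) [Fact q.Prime] (Φ k h a b s w v g : List ℤ) (n : ℕ)
    (hchk : dedChk q Φ k h a b s w v g n = true)
    {κ : K} (hκ : ev κ mL = 0) (hm : minpoly ℚ κ = pol ℚ mL)
    (x : K) (hx : IsIntegral ℤ x) (T : ℤ[X]) (hT : (q : K) * x = aeval κ T) :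
    ∃ Z : ℤ[X], x = aeval κ Z := by
  simp only [dedChk, Bool.and_eq_true] at hchk
  obtain ⟨c1, c2, c3, c4⟩ := hchk
  have hq : (((q : ℤ)) : (ZMod q)[X]) = 0 := by
    rw [Int.cast_natCast]; exact CharP.cast_eq_zero _ _
  have e1 := ev_isZ (X : ℤ[X]) _ c1
  have e2 := ev_isZ (X : (ZMod q)[X]) _ c2
  have e3 := ev_isZ (X : (ZMod q)[X]) _ c3
  have e4 := ev_isZ (X : (ZMod q)[X]) _ c4
  simp only [ev_addL Int.cast_zero, ev_smulL Int.cast_zero, ev_mulL Int.cast_zero] at e1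
  simp only [ev_addL hq, ev_mulL hq, ev_smulL hq, ev_npow hq, ev] at e2 e3 e4
  push_cast at e1 e2 e3 e4
  have hr : ∀ l, red q (pol ℤ l) = ev (X : (ZMod q)[X]) l := fun l => pol_map _ _
  have hcop : IsCoprime (red q (pol ℤ Φ)) (derivative (red q (pol ℤ Φ))) := by
    refine ⟨ev X a, ev X b, ?_⟩
    have hd : derivative (red q (pol ℤ Φ)) = ev (X : (ZMod q)[X]) (der Φ) := by
      rw [hr]; exact pol_der Φ
    rw [hd, hr]
    linear_combination e2
  have hsep : (red q (pol ℤ Φ)).Separable := hcop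
  refine dedekind κ (pol ℤ mL) (pol ℤ Φ) (pol ℤ k) (pol ℤ h) q (kappa_int hκ) (by rw [pol_eval, hκ])
    (kappa_ker hκ hm) ?_ hsep.ne_zero hsep.squarefree ⟨ev X s, ev X w, ev X v, ?_⟩ n ⟨ev X g, ?_⟩ x hx T hT
  · have : C (q : ℤ) = ((q : ℕ) : ℤ[X]) := by simp
    rw [this]
    simp only [pol]
    linear_combination -e1
  · simp only [hr]
    linear_combination e3
  · simp only [hr]
    linear_combination e4

theorem chk3 : dedChk (3 : ℕ) Ph3L k3L h3L a3L b3L s3L w3L v3L g3L 2 = true := by decide +kernel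
theorem chk97 : dedChk (97 : ℕ) Ph97L k97L h97L a97L b97L s97L w97L v97L g97L 1 = true := by decide +kernel

theorem part3 (hfr : Module.finrank ℚ K = 12) {κ : K} (hκ : ev κ mL = 0)
    (htop : Algebra.adjoin ℚ {κ} = ⊤) (hm : minpoly ℚ κ = pol ℚ mL) :
    3 ^ 16 ∣ NumberField.discr K := by
  have : Fact (Nat.Prime 3) := ⟨by norm_num⟩
  exact qpart 3 hfr hκ htop hm (ded_of 3 _ _ _ _ _ _ _ _ _ _ chk3 hκ hm) 16 (by norm_num)

theorem part97 (hfr : Module.finrank ℚ K = 12) {κ : K} (hκ : ev κ mL = 0)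
    (htop : Algebra.adjoin ℚ {κ} = ⊤) (hm : minpoly ℚ κ = pol ℚ mL) :
    97 ^ 4 ∣ NumberField.discr K := by
  have : Fact (Nat.Prime 97) := ⟨by norm_num⟩
  exact qpart 97 hfr hκ htop hm (ded_of 97 _ _ _ _ _ _ _ _ _ _ chk97 hκ hm) 4 (by norm_num)
end
end M11

namespace M11
open NumberField
section
variable {K : Type*} [Field K] [NumberField K]

theorem norm_k {κ : K} (hκ : ev κ mL = 0) (htop : Algebra.adjoin ℚ {κ} = ⊤)
    (hm : minpoly ℚ κ = pol ℚ mL) (k : 𝓞 K) (hk : (k : K) = κ) : Algebra.norm ℤ k = 220 := by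
  have h := Algebra.coe_norm_int k
  rw [hk] at h
  have hint : IsIntegral ℚ κ := (kappa_int hκ).tower_top
  have h2 := Algebra.PowerBasis.norm_gen_eq_coeff_zero_minpoly (PowerBasis.ofAdjoinEqTop hint htop)
  rw [PowerBasis.ofAdjoinEqTop_gen, PowerBasis.ofAdjoinEqTop_dim, hm, mL_natDegree, pol_coeff] at h2
  rw [h2] at h
  have h3 : ((Algebra.norm ℤ k : ℤ) : ℚ) = ((220 : ℤ) : ℚ) := by
    rw [h]; norm_num [mL]
  exact_mod_cast h3

theorem card4 {R : Type*} [CommRing R] [Nontrivial R] (w : R) (h2 : (2 : R) = 0)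
    (hw : w ^ 2 + w + 1 = 0) (f : ℕ) (hc : Nat.card R = 2 ^ f) : 4 ∣ Nat.card R := by
  have hfin : Finite R := Nat.finite_of_card_ne_zero (by rw [hc]; positivity)
  have w0 : w ≠ 0 := by rintro rfl; simp at hw
  have w1 : w ≠ 1 := by
    rintro rfl
    apply one_ne_zero (α := R)
    linear_combination hw - h2
  classical
  have := Fintype.ofFinite R
  have h3 : ({0, 1, w} : Finset R).card = 3 := by
    rw [Finset.card_insert_of_notMem, Finset.card_insert_of_notMem, Finset.card_singleton]
    · simpa using w1.symm
    · simp [w0.symm]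
  have h4 := Finset.card_le_univ ({0, 1, w} : Finset R)
  rw [h3, ← Nat.card_eq_fintype_card, hc] at h4
  rw [hc]
  have : 2 ≤ f := by
    by_contra hh
    interval_cases f <;> omega
  exact pow_dvd_pow 2 this

theorem part2 (hfr : Module.finrank ℚ K = 12) {κ : K} (hκ : ev κ mL = 0)
    (htop : Algebra.adjoin ℚ {κ} = ⊤) (hm : minpoly ℚ κ = pol ℚ mL) :
    2 ^ 8 ∣ NumberField.discr K := by
  obtain ⟨k, hk⟩ : ∃ k : 𝓞 K, (k : K) = κ := ⟨⟨κ, kappa_int hκ⟩, rfl⟩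
  obtain ⟨w, hw⟩ : ∃ w : 𝓞 K, (w : K) = κ ^ 5 * (κ ^ 2 + 3 * κ + 3) / 2 := ⟨⟨_, w_int hκ⟩, rfl⟩
  have hn := norm_k hκ htop hm k hk
  have r1 : 2 * w = k ^ 5 * (k ^ 2 + 3 * k + 3) := by
    apply RingOfIntegers.coe_injective
    simp only [map_add, map_mul, map_pow, map_ofNat, hk, hw]
    ring
  have r2 : w ^ 2 + (9 - 39 * k - 6 * k ^ 2 + 18 * k ^ 3 + 9 * k ^ 4) * w +
      (55 - 108 * k - 150 * k ^ 2 + 210 * k ^ 3 + 168 * k ^ 4) * (k ^ 2 + 3 * k + 3) = 0 := by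
    apply RingOfIntegers.coe_injective
    simp only [map_add, map_sub, map_mul, map_pow, map_ofNat, map_zero, hk, hw]
    simp only [mL, ev] at hκ
    push_cast at hκ
    linear_combination (κ ^ 2 + 3 * κ + 3) / 4 * hκ
  obtain ⟨P, hPm, hPu, hPd⟩ := Ideal.exists_isMaximal_dvd_of_dvd_absNorm' Nat.prime_two
    (Ideal.span {k}) (by rw [Ideal.absNorm_span_singleton, hn]; norm_num)
  have kP : k ∈ P := by
    rw [Ideal.dvd_span_singleton] at hPd; exact hPd
  have tP : (2 : 𝓞 K) ∈ P := by
    have : (2 : ℤ) ∈ P.under ℤ := by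
      rw [hPu]; exact Ideal.mem_span_singleton_self _
    simpa [Ideal.under] using this
  have h2 : (2 : 𝓞 K ⧸ P) = 0 := by
    have := Ideal.Quotient.eq_zero_iff_mem.2 tP
    rwa [map_ofNat] at this
  have hk0 := Ideal.Quotient.eq_zero_iff_mem.2 kP
  have hw1 : (Ideal.Quotient.mk P w) ^ 2 + Ideal.Quotient.mk P w + 1 = 0 := by
    have := congrArg (Ideal.Quotient.mk P) r2
    simp only [map_add, map_sub, map_mul, map_pow, map_ofNat, map_zero, hk0] at this
    linear_combination this - (4 * Ideal.Quotient.mk P w + 82) * h2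
  have : Nontrivial (𝓞 K ⧸ P) := Ideal.Quotient.nontrivial_iff.2 hPm.ne_top
  have wP : w ∉ P := by
    intro h
    rw [Ideal.Quotient.eq_zero_iff_mem.2 h] at hw1
    simp at hw1
  have n2 : (Ideal.span {(2 : 𝓞 K)}).absNorm = 2 ^ 12 := by
    have h := Algebra.norm_algebraMap (S := 𝓞 K) (2 : ℤ)
    rw [RingOfIntegers.rank, hfr] at h
    rw [Ideal.absNorm_span_singleton]
    rw [show (2 : 𝓞 K) = algebraMap ℤ (𝓞 K) 2 by simp, h]
    rfl
  have c4 : 4 ∣ P.absNorm := by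
    have hd := Ideal.absNorm_dvd_absNorm_of_le ((Ideal.span_singleton_le_iff_mem P).2 tP)
    rw [n2] at hd
    obtain ⟨f, -, hf⟩ := (Nat.dvd_prime_pow Nat.prime_two).1 hd
    exact card4 (R := 𝓞 K ⧸ P) (Ideal.Quotient.mk P w) h2 hw1 f hf
  have h5 : (2 : 𝓞 K) ∈ P ^ 5 := by
    have : w * 2 ∈ P ^ 5 := by
      rw [mul_comm, r1]
      exact Ideal.mul_mem_right _ _ (Ideal.pow_mem_pow kP 5)
    exact (Ideal.IsMaximal.mul_mem_pow P this).resolve_left wP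
  have hmax : (Ideal.span {(2 : ℤ)}).IsMaximal := by
    have : Fact (Nat.Prime 2) := ⟨Nat.prime_two⟩
    exact Int.ideal_span_isMaximal_of_prime 2
  have hdiff := pow_sub_one_dvd_differentIdeal ℤ (p := Ideal.span {(2 : ℤ)}) P 5 (by simp) (by
    rw [Ideal.map_span, Set.image_singleton, Ideal.dvd_span_singleton]
    simpa using h5)
  have h6 := Ideal.absNorm_dvd_absNorm_of_le (Ideal.dvd_iff_le.1 hdiff)
  rw [NumberField.absNorm_differentIdeal K, map_pow] at h6
  have h7 := (pow_dvd_pow_of_dvd c4 4).trans h6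
  rw [← Int.natCast_dvd] at h7
  simpa using h7
end

theorem disc_final {K : Type} [Field K] [NumberField K] (hirr : Irreducible f0)
    (e : AdjoinRoot f0 ≃ₐ[ℚ] K) :
    Module.finrank ℚ K = 12 ∧ NumberField.discr K = 2 ^ 8 * 3 ^ 16 * 97 ^ 4 := by
  have hfr := finrank12 hirr e
  refine ⟨hfr, ?_⟩
  have hα : ev (e (AdjoinRoot.root f0)) fl = 0 := by
    rw [← f0_root, aeval_algHom_apply]
    simp
  obtain ⟨κ, t, ht, hA, hκ, htop, hm⟩ := kappa_full hirr hfr _ hα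
  obtain ⟨c, hc⟩ := upper hfr hκ ht hA htop hm
  have p2 := part2 hfr hκ htop hm
  have p3 := part3 hfr hκ htop hm
  have p97 := part97 hfr hκ htop hm
  have q1 : (2 ^ 8 * 3 ^ 16 : ℤ) ∣ discr K :=
    IsCoprime.mul_dvd (by rw [Int.isCoprime_iff_gcd_eq_one]; norm_num) p2 p3
  have q2 : (2 ^ 8 * 3 ^ 16 * 97 ^ 4 : ℤ) ∣ discr K :=
    IsCoprime.mul_dvd (by rw [Int.isCoprime_iff_gcd_eq_one]; norm_num) q1 p97
  have hpos : 0 < discr K := by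
    have h0 : (0 : ℤ) < c ^ 2 * discr K := by rw [← hc]; norm_num
    exact pos_of_mul_pos_right h0 (sq_nonneg c)
  exact Int.dvd_antisymm hpos.le (by norm_num) (hc ▸ Dvd.intro_left _ rfl) q2
end M11

theorem m11_field_small_disc :
    Irreducible f0 ∧
    IsSimpleGroup f0.Gal ∧ Nat.card f0.Gal = 7920 ∧
    ∀ (K : Type) [Field K] [NumberField K],
      Nonempty (AdjoinRoot f0 ≃ₐ[ℚ] K) →
      Module.finrank ℚ K = 12 ∧ NumberField.discr K = 2 ^ 8 * 3 ^ 16 * 97 ^ 4 := by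
  obtain ⟨h1, h2, h3⟩ := M11.gal_final
  exact ⟨h1, h2, h3, fun K _ _ ⟨e⟩ => M11.disc_final h1 e⟩
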